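/- arXiv:2301.10648 — 4 statements merged into one kernel-verified Lean document; each statement's English description precedes it below -/
import Mathlib

section
/- Let A:[0,∞)→[0,∞) be a strictly increasing bijection that is submultiplicative, i.e. A(st) ≤ c_A A(s)A(t) for all s,t≥0 and some c_A≥1. Let μ be a measure, let F and f be measurable functions, and suppose there is c>0 such that for every t>0, μ({x : |F(x)|>t}) ≤ c ∫ A(|f|/t) dμ. Then ‖F‖_{L^{B,∞}(μ)} ≤ λ_0 ‖f‖_{A(μ)}, where B(t) := 1/A(1/t) and λ_0 := 1/A^{-1}(1/(c·c_A²)); in particular there is a constant depending only on c, c_A and A such that ‖F‖_{L^{B,∞}(μ)} ≲ ‖f‖_{A(μ)}. -/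
open MeasureTheory Set
open scoped ENNReal

noncomputable section

/-- The weak Orlicz quasinorm `‖f‖_{L^{A,∞}(μ)}`. -/
def weakOrliczNorm {X : Type*} [MeasurableSpace X] (A : ℝ → ℝ) (μ : Measure X)
    (f : X → ℝ) : ℝ≥0∞ :=
  sInf {l : ℝ≥0∞ | ∀ t : ℝ, 0 < t →
    ENNReal.ofReal (A t) * μ {x | l * ENNReal.ofReal t < ENNReal.ofReal |f x|} ≤ 1}

/-- The Luxemburg norm `‖f‖_{A(μ)}`. -/
def luxemburgNorm {X : Type*} [MeasurableSpace X] (A : ℝ → ℝ) (μ : Measure X)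
    (f : X → ℝ) : ℝ≥0∞ :=
  sInf {l : ℝ≥0∞ | ∃ lr : ℝ, 0 < lr ∧ l = ENNReal.ofReal lr ∧
    ∫⁻ x, ENNReal.ofReal (A (|f x| / lr)) ∂μ ≤ 1}

/-- The decreasing rearrangement `f^*_μ`. -/
def rearrangement {X : Type*} [MeasurableSpace X] (μ : Measure X) (f : X → ℝ)
    (s : ℝ) : ℝ≥0∞ :=
  sInf {t : ℝ≥0∞ | μ {x | t < ENNReal.ofReal |f x|} ≤ ENNReal.ofReal s}

/-- Lemma 2.2, (1) ⟹ (2): a modular weak type inequality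
`μ({|F| > t}) ≤ c ∫ A(|f|/t) dμ` for a submultiplicative strictly increasing
bijection `A` of `[0,∞)` implies `‖F‖_{L^{B,∞}(μ)} ≤ λ₀ ‖f‖_{A(μ)}` with
`B(t) = 1/A(1/t)` and `λ₀ = 1/A⁻¹(1/(c · c_A²))`. -/
theorem modular_implies_weakOrlicz
    {X : Type*} [MeasurableSpace X] (μ : Measure X)
    (A : ℝ → ℝ) (hA : StrictMonoOn A (Set.Ici 0)) (hAbij : Set.BijOn A (Set.Ici 0) (Set.Ici 0))
    (cA : ℝ) (hcA : 1 ≤ cA)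
    (hsub : ∀ s t : ℝ, 0 ≤ s → 0 ≤ t → A (s * t) ≤ cA * A s * A t)
    (F f : X → ℝ) (c : ℝ) (hc : 0 < c)
    (hwk : ∀ t : ℝ, 0 < t →
      μ {x | t < |F x|} ≤ ENNReal.ofReal c * ∫⁻ x, ENNReal.ofReal (A (|f x| / t)) ∂μ) :
    weakOrliczNorm (fun t => 1 / A (1 / t)) μ F ≤
      ENNReal.ofReal (1 / Function.invFunOn A (Set.Ici 0) (1 / (c * cA ^ 2))) *
        luxemburgNorm A μ f := by
  have hA0 : A 0 = 0 := by
    obtain ⟨z, hz, hz0⟩ := hAbij.surjOn (Set.mem_Ici.2 le_rfl)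
    exact le_antisymm (hz0 ▸ hA.monotoneOn Set.self_mem_Ici hz hz)
      (hAbij.mapsTo Set.self_mem_Ici)
  have hApos : ∀ t, 0 < t → 0 < A t := fun t ht => by
    simpa [hA0] using hA Set.self_mem_Ici (Set.mem_Ici.2 ht.le) ht
  have hcA0 : 0 < cA := by linarith
  have hmem : 1 / (c * cA ^ 2) ∈ A '' Set.Ici 0 := hAbij.surjOn (Set.mem_Ici.2 (by positivity))
  set a := Function.invFunOn A (Set.Ici 0) (1 / (c * cA ^ 2))
  have ha_eq : A a = 1 / (c * cA ^ 2) := Function.invFunOn_eq hmem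
  have ha_nonneg : 0 ≤ a := Function.invFunOn_mem hmem
  have ha_pos : 0 < a := by
    refine ha_nonneg.lt_of_ne fun h => ?_
    rw [← h, hA0] at ha_eq
    exact absurd ha_eq (by positivity)
  have hlam : ENNReal.ofReal (1 / a) ≠ 0 := (ENNReal.ofReal_pos.2 (by positivity)).ne'
  rw [← ENNReal.div_le_iff' hlam ENNReal.ofReal_ne_top]
  refine le_sInf ?_
  rintro _ ⟨r, hr, rfl, hint⟩
  rw [ENNReal.div_le_iff' hlam ENNReal.ofReal_ne_top]
  refine sInf_le fun t ht => ?_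
  have hAt : 0 < A (1 / t) := hApos _ (by positivity)
  have hs : 0 < 1 / a * r * t := by positivity
  have hset : {x | ENNReal.ofReal (1 / a) * ENNReal.ofReal r * ENNReal.ofReal t <
      ENNReal.ofReal |F x|} = {x | 1 / a * r * t < |F x|} := by
    ext x
    rw [Set.mem_ofPred_eq, Set.mem_ofPred_eq, ← ENNReal.ofReal_mul (by positivity),
      ← ENNReal.ofReal_mul (by positivity), ENNReal.ofReal_lt_ofReal_iff_of_nonneg hs.le]
  have hpt : ∀ x, A (|f x| / (1 / a * r * t)) ≤ A (1 / t) / c * A (|f x| / r) := fun x => by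
    have hu : 0 ≤ |f x| / r := by positivity
    have h1 := hsub (a * (1 / t)) (|f x| / r) (by positivity) hu
    have h2 := hsub a (1 / t) ha_nonneg (by positivity)
    have hAu : 0 ≤ A (|f x| / r) := hAbij.mapsTo hu
    calc A (|f x| / (1 / a * r * t)) = A (a * (1 / t) * (|f x| / r)) := by
          congr 1; field_simp
      _ ≤ cA * A (a * (1 / t)) * A (|f x| / r) := h1
      _ ≤ cA * (cA * A a * A (1 / t)) * A (|f x| / r) := by gcongr
      _ = A (1 / t) / c * A (|f x| / r) := by rw [ha_eq]; field_simp
  have hmeas : μ {x | 1 / a * r * t < |F x|} ≤ ENNReal.ofReal (A (1 / t)) := calc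
    μ {x | 1 / a * r * t < |F x|}
        ≤ ENNReal.ofReal c * ∫⁻ x, ENNReal.ofReal (A (|f x| / (1 / a * r * t))) ∂μ := hwk _ hs
    _ ≤ ENNReal.ofReal c *
        ∫⁻ x, ENNReal.ofReal (A (1 / t) / c) * ENNReal.ofReal (A (|f x| / r)) ∂μ := by
      gcongr with x
      rw [← ENNReal.ofReal_mul (by positivity)]
      exact ENNReal.ofReal_le_ofReal (hpt x)
    _ = ENNReal.ofReal (A (1 / t)) * ∫⁻ x, ENNReal.ofReal (A (|f x| / r)) ∂μ := by
      rw [lintegral_const_mul' _ _ ENNReal.ofReal_ne_top, ← mul_assoc,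
        ← ENNReal.ofReal_mul hc.le, mul_div_cancel₀ _ hc.ne']
    _ ≤ ENNReal.ofReal (A (1 / t)) := mul_le_of_le_one_right' hint
  rw [hset]
  calc ENNReal.ofReal (1 / A (1 / t)) * μ {x | 1 / a * r * t < |F x|}
      ≤ ENNReal.ofReal (1 / A (1 / t)) * ENNReal.ofReal (A (1 / t)) := by gcongr
    _ = 1 := by
      rw [← ENNReal.ofReal_mul (by positivity), one_div_mul_cancel hAt.ne', ENNReal.ofReal_one]

end
end

section
/- Let (X,μ) be a σ-finite measure space, 1≤p_0<∞, and let T be a sublinear operator on measurable functions, i.e. |T(g+h)| ≤ |Tg| + |Th| a.e.. Suppose that ‖Tf‖_{L^{p_0,∞}(μ)} ≤ C_0 ‖f‖_{L^{p_0,1}(μ)} and ‖Tf‖_{L^∞} ≤ C_1 ‖f‖_{L^∞} for all f. Let A be a strictly increasing bijection of [0,∞) such that for some κ>1 one has ∫_s^∞ (1/A^{-1}(1/t)) t^{-1/p_0} dt/t ≤ κ · s^{-1/p_0}/A^{-1}(1/s) for all s>0. Then ‖Tf‖_{L^{A,1}(μ)} ≤ 2(C_1 + C_0 κ) ‖f‖_{L^{A,1}(μ)}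 for all f with ‖f‖_{L^{A,1}(μ)} finite. -/
open MeasureTheory Set
open scoped ENNReal

noncomputable section

/-- The Lorentz `L^{p,∞}(μ)` quasinorm `sup_{s>0} s^{1/p} f^*_μ(s)`. -/
def lorentzWeakNorm {X : Type*} [MeasurableSpace X] (p : ℝ) (μ : Measure X)
    (f : X → ℝ) : ℝ≥0∞ :=
  ⨆ (s : ℝ) (_ : 0 < s), ENNReal.ofReal (s ^ (1 / p)) * rearrangement μ f s

/-- The Lorentz `L^{p,1}(μ)` norm `∫_0^∞ s^{1/p} f^*_μ(s) ds/s`. -/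
def lorentz1Norm {X : Type*} [MeasurableSpace X] (p : ℝ) (μ : Measure X)
    (f : X → ℝ) : ℝ≥0∞ :=
  ∫⁻ s in Set.Ioi (0 : ℝ),
    ENNReal.ofReal (s ^ (1 / p)) * rearrangement μ f s / ENNReal.ofReal s

/-- `‖f‖_{L^{A,1}(μ)} = ∫_0^∞ f^*_μ(s)/A⁻¹(1/s) ds/s`, given the inverse `Ainv` of `A`. -/
def orliczLorentz1Norm {X : Type*} [MeasurableSpace X] (Ainv : ℝ → ℝ) (μ : Measure X)
    (f : X → ℝ) : ℝ≥0∞ :=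
  ∫⁻ s in Set.Ioi (0 : ℝ),
    rearrangement μ f s / ENNReal.ofReal (Ainv (1 / s)) / ENNReal.ofReal s

/-- A function splits at height `a` into a part bounded by `a` and a part that is dominated by
the function and vanishes where the function is at most `a`. -/
lemma exists_truncation {X : Type*} (f : X → ℝ) {a : ℝ} (ha : 0 ≤ a) :
    ∃ g h : X → ℝ, f = g + h ∧ (∀ x, |g x| ≤ a) ∧ (∀ x, |h x| ≤ |f x|) ∧
      ∀ x, |f x| ≤ a → h x = 0 := by
  refine ⟨fun x => max (-a) (min a (f x)), fun x => f x - max (-a) (min a (f x)),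
    by ext x; simp, fun x => ?_, fun x => ?_, fun x hx => ?_⟩
  · exact abs_le.2 ⟨le_max_left _ _, max_le (by linarith) (min_le_left _ _)⟩
  · beta_reduce
    rcases le_total a (f x) with h1 | h1
    · rw [min_eq_left h1, max_eq_right (by linarith), abs_of_nonneg (by linarith),
        abs_of_nonneg (by linarith)]
      linarith
    · rw [min_eq_right h1]
      rcases le_total (-a) (f x) with h2 | h2
      · simp [max_eq_right h2]
      · rw [max_eq_left h2, abs_of_nonpos (by linarith), abs_of_nonpos (by linarith)]
        linarith
  · obtain ⟨h1, h2⟩ := abs_le.1 hx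
    simp [min_eq_right h2, max_eq_right h1]

section Rearrangement

variable {X : Type*} [MeasurableSpace X] {μ : Measure X}

lemma measure_rearrangement_lt_le (f : X → ℝ) (s : ℝ) :
    μ {x | rearrangement μ f s < ENNReal.ofReal |f x|} ≤ ENNReal.ofReal s := by
  set S : Set ℝ≥0∞ := {t | μ {x | t < ENNReal.ofReal |f x|} ≤ ENNReal.ofReal s} with hS
  have hne : S.Nonempty := ⟨⊤, by simp [hS]⟩
  obtain ⟨u, hu_anti, hu_lim, hu_mem⟩ := exists_seq_tendsto_sInf hne (OrderBot.bddBelow S)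
  have hset : {x | rearrangement μ f s < ENNReal.ofReal |f x|} =
      ⋃ n, {x | u n < ENNReal.ofReal |f x|} := by
    ext x
    simp only [mem_ofPred_eq, mem_iUnion]
    constructor
    · intro hx
      exact (hu_lim.eventually (gt_mem_nhds hx)).exists
    · rintro ⟨n, hn⟩
      exact (sInf_le (hu_mem n)).trans_lt hn
  have hmono : Monotone fun n => {x | u n < ENNReal.ofReal |f x|} :=
    fun m n hmn x hx => (hu_anti hmn).trans_lt hx
  rw [hset, hmono.measure_iUnion]
  exact iSup_le hu_mem

lemma rearrangement_le_of_measure_le {f : X → ℝ} {s : ℝ} {a : ℝ≥0∞}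
    (h : μ {x | a < ENNReal.ofReal |f x|} ≤ ENNReal.ofReal s) : rearrangement μ f s ≤ a :=
  sInf_le h

lemma rearrangement_antitone (f : X → ℝ) : Antitone (rearrangement μ f) := fun _ _ hst =>
  rearrangement_le_of_measure_le
    ((measure_rearrangement_lt_le f _).trans (ENNReal.ofReal_le_ofReal hst))

lemma rearrangement_le_add_of_ae_le {f g : X → ℝ} {a : ℝ≥0∞}
    (h : ∀ᵐ x ∂μ, ENNReal.ofReal |f x| ≤ a + ENNReal.ofReal |g x|) (s : ℝ) :
    rearrangement μ f s ≤ a + rearrangement μ g s := by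
  refine rearrangement_le_of_measure_le
    ((measure_mono_ae ?_).trans (measure_rearrangement_lt_le g s))
  filter_upwards [h] with x hx hlt
  exact lt_of_add_lt_add_left (lt_of_lt_of_le hlt hx)

lemma rearrangement_mono {f g : X → ℝ} (h : ∀ x, |f x| ≤ |g x|) (s : ℝ) :
    rearrangement μ f s ≤ rearrangement μ g s := by
  simpa using rearrangement_le_add_of_ae_le (μ := μ) (a := 0)
    (.of_forall fun x => by simpa using ENNReal.ofReal_le_ofReal (h x)) s

lemma lorentz1Norm_le_of_truncation {f h : X → ℝ} {s p : ℝ} (hle : ∀ x, |h x| ≤ |f x|)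
    (hzero : ∀ x, ENNReal.ofReal |f x| ≤ rearrangement μ f s → h x = 0) :
    lorentz1Norm p μ h ≤ ∫⁻ t in Ioi (0 : ℝ), (Iio s).indicator
      (fun t => ENNReal.ofReal (t ^ (1 / p)) * rearrangement μ f t / ENNReal.ofReal t) t := by
  refine lintegral_mono fun t => ?_
  by_cases hts : t < s
  · rw [indicator_of_mem (mem_Iio.2 hts)]
    gcongr
    exact rearrangement_mono hle t
  · have h0 : rearrangement μ h t = 0 := by
      refine le_antisymm (rearrangement_le_of_measure_le ?_) bot_le
      calc μ {x | 0 < ENNReal.ofReal |h x|}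
          ≤ μ {x | rearrangement μ f s < ENNReal.ofReal |f x|} := by
            refine measure_mono fun x hx => ?_
            by_contra hcon
            have := hzero x (not_lt.1 hcon)
            simp [this] at hx
        _ ≤ ENNReal.ofReal s := measure_rearrangement_lt_le f s
        _ ≤ ENNReal.ofReal t := ENNReal.ofReal_le_ofReal (not_lt.1 hts)
    simp [h0]

lemma rearrangement_sublinear_le {p C₀ C₁ : ℝ} {T : (X → ℝ) → (X → ℝ)}
    (hsub : ∀ g h : X → ℝ, ∀ᵐ x ∂μ, |T (g + h) x| ≤ |T g x| + |T h x|)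
    (hT₀ : ∀ f : X → ℝ, lorentzWeakNorm p μ (T f) ≤ ENNReal.ofReal C₀ * lorentz1Norm p μ f)
    (hT₁ : ∀ f : X → ℝ, eLpNorm (T f) ⊤ μ ≤ ENNReal.ofReal C₁ * eLpNorm f ⊤ μ)
    (f : X → ℝ) {s : ℝ} (hs : 0 < s) (hfin : rearrangement μ f s ≠ ⊤) :
    rearrangement μ (T f) s ≤ ENNReal.ofReal C₁ * rearrangement μ f s +
      ENNReal.ofReal C₀ * (ENNReal.ofReal (s ^ (-1 / p)) *
        ∫⁻ t in Ioi (0 : ℝ), (Iio s).indicator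
          (fun t => ENNReal.ofReal (t ^ (1 / p)) * rearrangement μ f t / ENNReal.ofReal t) t) := by
  obtain ⟨g, h, hfgh, hg, hhf, hh0⟩ :=
    exists_truncation f (ENNReal.toReal_nonneg (a := rearrangement μ f s))
  have hgT : ∀ᵐ x ∂μ, ENNReal.ofReal |T g x| ≤ ENNReal.ofReal C₁ * rearrangement μ f s := by
    have hgn : eLpNorm g ⊤ μ ≤ rearrangement μ f s := by
      rw [eLpNorm_exponent_top, ← ENNReal.ofReal_toReal hfin]
      exact eLpNormEssSup_le_of_ae_bound (.of_forall hg)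
    have hle := (hT₁ g).trans (mul_le_mul_right hgn _)
    rw [eLpNorm_exponent_top] at hle
    filter_upwards [ae_le_eLpNormEssSup (f := T g) (μ := μ)] with x hx
    rw [← Real.norm_eq_abs, ofReal_norm]
    exact hx.trans hle
  have hTf : ∀ᵐ x ∂μ, ENNReal.ofReal |T f x| ≤
      ENNReal.ofReal C₁ * rearrangement μ f s + ENNReal.ofReal |T h x| := by
    filter_upwards [hgT, hsub g h] with x hx hx'
    rw [← hfgh] at hx'
    refine (ENNReal.ofReal_le_ofReal hx').trans (ENNReal.ofReal_add_le.trans ?_)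
    gcongr
  refine (rearrangement_le_add_of_ae_le hTf s).trans (add_le_add_right ?_ _)
  have hnorm := lorentz1Norm_le_of_truncation (μ := μ) (p := p) hhf
    fun x hx => hh0 x ((ENNReal.ofReal_le_iff_le_toReal hfin).1 hx)
  have hweak : ENNReal.ofReal (s ^ (1 / p)) * rearrangement μ (T h) s ≤
      ENNReal.ofReal C₀ * lorentz1Norm p μ h :=
    (le_iSup₂ (f := fun (s : ℝ) (_ : 0 < s) =>
      ENNReal.ofReal (s ^ (1 / p)) * rearrangement μ (T h) s) s hs).trans (hT₀ h)
  have hone : ENNReal.ofReal (s ^ (-1 / p)) * ENNReal.ofReal (s ^ (1 / p)) = 1 := by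
    rw [← ENNReal.ofReal_mul (by positivity), ← Real.rpow_add hs]
    simp [neg_div]
  calc rearrangement μ (T h) s
      = ENNReal.ofReal (s ^ (-1 / p)) *
          (ENNReal.ofReal (s ^ (1 / p)) * rearrangement μ (T h) s) := by
        rw [← mul_assoc, hone, one_mul]
    _ ≤ ENNReal.ofReal (s ^ (-1 / p)) * (ENNReal.ofReal C₀ * lorentz1Norm p μ h) := by gcongr
    _ = ENNReal.ofReal C₀ * (ENNReal.ofReal (s ^ (-1 / p)) * lorentz1Norm p μ h) := by ring
    _ ≤ _ := by gcongr

lemma aemeasurable_comp_one_div {B : ℝ → ℝ} (hB : MonotoneOn B (Ioi 0)) :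
    AEMeasurable (fun s => B (1 / s)) (volume.restrict (Ioi 0)) :=
  aemeasurable_restrict_of_antitoneOn measurableSet_Ioi fun _ hs _ ht hst =>
    hB (mem_Ioi.2 (one_div_pos.2 ht)) (mem_Ioi.2 (one_div_pos.2 hs))
      (one_div_le_one_div_of_le hs hst)

/-- The Orlicz–Lorentz norm of the Hardy-type average arising from the `L^{p,1}` endpoint. -/
lemma lintegral_hardy_le {B : ℝ → ℝ} {p κ : ℝ} (hB : MonotoneOn B (Ioi 0))
    (hBpos : ∀ t, 0 < t → 0 < B t)
    (hint : ∀ s : ℝ, 0 < s →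
      (∫⁻ t in Ioi s, ENNReal.ofReal ((1 / B (1 / t)) * t ^ (-1 / p) / t)) ≤
        ENNReal.ofReal (κ * s ^ (-1 / p) / B (1 / s)))
    (hκ : 0 ≤ κ) (f : X → ℝ) :
    ∫⁻ s in Ioi (0 : ℝ), (ENNReal.ofReal (s ^ (-1 / p)) *
        ∫⁻ t in Ioi (0 : ℝ), (Iio s).indicator
          (fun t => ENNReal.ofReal (t ^ (1 / p)) * rearrangement μ f t / ENNReal.ofReal t) t) /
        ENNReal.ofReal (B (1 / s)) / ENNReal.ofReal s ≤
      ENNReal.ofReal κ * orliczLorentz1Norm B μ f := by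
  set K : ℝ → ℝ≥0∞ := fun s => ENNReal.ofReal ((1 / B (1 / s)) * s ^ (-1 / p) / s) with hK
  set G : ℝ → ℝ≥0∞ :=
    fun t => ENNReal.ofReal (t ^ (1 / p)) * rearrangement μ f t / ENNReal.ofReal t with hG
  have hKm : AEMeasurable K (volume.restrict (Ioi 0)) := by
    have := aemeasurable_comp_one_div hB
    refine AEMeasurable.ennreal_ofReal (.div (.mul (this.const_div 1) ?_) aemeasurable_id)
    fun_prop
  have hGm : Measurable G := by
    have := (rearrangement_antitone (μ := μ) f).measurable
    fun_prop
  calc _ = ∫⁻ s in Ioi (0 : ℝ), ∫⁻ t in Ioi (0 : ℝ),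
          {q : ℝ × ℝ | q.2 < q.1}.indicator (fun q => K q.1 * G q.2) (s, t) := by
        refine setLIntegral_congr_fun measurableSet_Ioi fun s hs => ?_
        have hs' : 0 < s := hs
        have hBs := hBpos _ (one_div_pos.2 hs')
        have hKs : K s = ENNReal.ofReal (s ^ (-1 / p)) / ENNReal.ofReal (B (1 / s)) /
            ENNReal.ofReal s := by
          rw [← ENNReal.ofReal_div_of_pos hBs, ← ENNReal.ofReal_div_of_pos hs']
          simp only [hK]
          congr 1
          ring
        have hind : ∀ t, {q : ℝ × ℝ | q.2 < q.1}.indicator (fun q => K q.1 * G q.2) (s, t) =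
            K s * (Iio s).indicator G t := fun t => by
          by_cases hts : t < s <;> simp [indicator, hts]
        simp only [hind]
        rw [lintegral_const_mul _ (hGm.indicator measurableSet_Iio), hKs]
        simp only [div_eq_mul_inv]
        ring
    _ = ∫⁻ t in Ioi (0 : ℝ), ∫⁻ s in Ioi (0 : ℝ),
          {q : ℝ × ℝ | q.2 < q.1}.indicator (fun q => K q.1 * G q.2) (s, t) := by
        refine lintegral_lintegral_swap ?_
        refine AEMeasurable.indicator ?_ (measurableSet_lt measurable_snd measurable_fst)
        exact hKm.comp_fst.mul (hGm.comp measurable_snd).aemeasurable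
    _ ≤ ∫⁻ t in Ioi (0 : ℝ), ENNReal.ofReal κ *
          (rearrangement μ f t / ENNReal.ofReal (B (1 / t)) / ENNReal.ofReal t) := by
        refine setLIntegral_mono' measurableSet_Ioi fun t ht => ?_
        have ht' : 0 < t := ht
        have hBt := hBpos _ (one_div_pos.2 ht')
        have hind : ∀ s, {q : ℝ × ℝ | q.2 < q.1}.indicator (fun q => K q.1 * G q.2) (s, t) =
            (Ioi t).indicator (fun s => K s * G t) s := fun s => by
          by_cases hts : t < s <;> simp [indicator, hts]
        have hone : ENNReal.ofReal (t ^ (-1 / p)) * ENNReal.ofReal (t ^ (1 / p)) = 1 := by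
          rw [← ENNReal.ofReal_mul (by positivity), ← Real.rpow_add ht']
          simp [neg_div]
        simp only [hind]
        rw [lintegral_indicator measurableSet_Ioi, Measure.restrict_restrict measurableSet_Ioi,
          inter_eq_left.2 (Ioi_subset_Ioi ht'.le),
          lintegral_mul_const'' _ (hKm.mono_measure
            (Measure.restrict_mono (Ioi_subset_Ioi ht'.le) le_rfl))]
        calc _ ≤ ENNReal.ofReal (κ * t ^ (-1 / p) / B (1 / t)) * G t := by
              gcongr
              exact hint t ht'
          _ = (ENNReal.ofReal (t ^ (-1 / p)) * ENNReal.ofReal (t ^ (1 / p))) *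
              (ENNReal.ofReal κ *
                (rearrangement μ f t / ENNReal.ofReal (B (1 / t)) / ENNReal.ofReal t)) := by
              rw [ENNReal.ofReal_div_of_pos hBt, ENNReal.ofReal_mul hκ, hG]
              simp only [div_eq_mul_inv]
              ring
          _ = _ := by rw [hone, one_mul]
    _ = _ := by
        rw [lintegral_const_mul' _ _ ENNReal.ofReal_ne_top]
        rfl

lemma rearrangement_ne_top_of_orliczLorentz1Norm_lt_top {B : ℝ → ℝ} {f : X → ℝ}
    (hf : orliczLorentz1Norm B μ f < ⊤) {s : ℝ} (hs : 0 < s) : rearrangement μ f s ≠ ⊤ := by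
  intro htop
  have hle : ∫⁻ _ in Ioo 0 s, (⊤ : ℝ≥0∞) ≤ orliczLorentz1Norm B μ f := by
    refine le_trans ?_ (lintegral_mono_set (Ioo_subset_Ioi_self (a := s) (b := 0)))
    refine setLIntegral_mono' measurableSet_Ioo fun t ht => ?_
    have : rearrangement μ f t = ⊤ := top_le_iff.1 (htop ▸ rearrangement_antitone f ht.2.le)
    simp [this, ENNReal.top_div_of_ne_top]
  rw [setLIntegral_const, Real.volume_Ioo, sub_zero,
    ENNReal.top_mul (ENNReal.ofReal_pos.2 hs).ne'] at hle
  exact hf.not_ge hle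

/-- Interpolation between `L^{p,1} → L^{p,∞}` and `L^∞` in the Orlicz scale, with the inverse of
the Orlicz function replaced by a monotone positive function `B`. -/
lemma orliczLorentz1Norm_sublinear_le {B : ℝ → ℝ} {p κ C₀ C₁ : ℝ} {T : (X → ℝ) → (X → ℝ)}
    (hsub : ∀ g h : X → ℝ, ∀ᵐ x ∂μ, |T (g + h) x| ≤ |T g x| + |T h x|)
    (hC₀ : 0 ≤ C₀) (hC₁ : 0 ≤ C₁)
    (hT₀ : ∀ f : X → ℝ, lorentzWeakNorm p μ (T f) ≤ ENNReal.ofReal C₀ * lorentz1Norm p μ f)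
    (hT₁ : ∀ f : X → ℝ, eLpNorm (T f) ⊤ μ ≤ ENNReal.ofReal C₁ * eLpNorm f ⊤ μ)
    (hB : MonotoneOn B (Ioi 0)) (hBpos : ∀ t, 0 < t → 0 < B t) (hκ : 0 ≤ κ)
    (hint : ∀ s : ℝ, 0 < s →
      (∫⁻ t in Ioi s, ENNReal.ofReal ((1 / B (1 / t)) * t ^ (-1 / p) / t)) ≤
        ENNReal.ofReal (κ * s ^ (-1 / p) / B (1 / s)))
    {f : X → ℝ} (hf : orliczLorentz1Norm B μ f < ⊤) :
    orliczLorentz1Norm B μ (T f) ≤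
      ENNReal.ofReal (C₁ + C₀ * κ) * orliczLorentz1Norm B μ f := by
  have hmeas : AEMeasurable (fun s => ENNReal.ofReal C₁ *
      (rearrangement μ f s / ENNReal.ofReal (B (1 / s)) / ENNReal.ofReal s))
      (volume.restrict (Ioi 0)) := by
    have h1 := (rearrangement_antitone (μ := μ) f).measurable.aemeasurable
      (μ := volume.restrict (Ioi 0))
    have h2 := (aemeasurable_comp_one_div hB).ennreal_ofReal
    exact ((h1.div h2).div (by fun_prop)).const_mul _
  set H : ℝ → ℝ≥0∞ := fun s => ENNReal.ofReal (s ^ (-1 / p)) *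
    ∫⁻ t in Ioi (0 : ℝ), (Iio s).indicator
      (fun t => ENNReal.ofReal (t ^ (1 / p)) * rearrangement μ f t / ENNReal.ofReal t) t
  calc orliczLorentz1Norm B μ (T f)
      ≤ ∫⁻ s in Ioi (0 : ℝ),
          (ENNReal.ofReal C₁ *
            (rearrangement μ f s / ENNReal.ofReal (B (1 / s)) / ENNReal.ofReal s) +
          ENNReal.ofReal C₀ * (H s / ENNReal.ofReal (B (1 / s)) / ENNReal.ofReal s)) := by
        refine setLIntegral_mono' measurableSet_Ioi fun s hs => ?_
        calc _ ≤ (ENNReal.ofReal C₁ * rearrangement μ f s + ENNReal.ofReal C₀ * H s) /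
              ENNReal.ofReal (B (1 / s)) / ENNReal.ofReal s := by
              gcongr
              exact rearrangement_sublinear_le hsub hT₀ hT₁ f hs
                (rearrangement_ne_top_of_orliczLorentz1Norm_lt_top hf hs)
          _ = _ := by
              simp only [div_eq_mul_inv]
              ring
    _ = ENNReal.ofReal C₁ * orliczLorentz1Norm B μ f + ENNReal.ofReal C₀ *
          ∫⁻ s in Ioi (0 : ℝ), H s / ENNReal.ofReal (B (1 / s)) / ENNReal.ofReal s := by
        rw [lintegral_add_left' hmeas, lintegral_const_mul' _ _ ENNReal.ofReal_ne_top,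
          lintegral_const_mul' _ _ ENNReal.ofReal_ne_top]
        rfl
    _ ≤ ENNReal.ofReal C₁ * orliczLorentz1Norm B μ f +
          ENNReal.ofReal C₀ * (ENNReal.ofReal κ * orliczLorentz1Norm B μ f) := by
        gcongr
        exact lintegral_hardy_le hB hBpos hint hκ f
    _ = ENNReal.ofReal (C₁ + C₀ * κ) * orliczLorentz1Norm B μ f := by
        rw [ENNReal.ofReal_add hC₁ (by positivity), ENNReal.ofReal_mul hC₀]
        ring

end Rearrangement

section InverseFunction

variable {A : ℝ → ℝ}

lemma strictMonoOn_invFunOn_Ici (hA : StrictMonoOn A (Ici 0)) (hAbij : BijOn A (Ici 0) (Ici 0)) :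
    StrictMonoOn (Function.invFunOn A (Ici 0)) (Ici 0) := by
  have hmem := hAbij.surjOn.mapsTo_invFunOn
  have hinv := hAbij.surjOn.rightInvOn_invFunOn
  intro s hs t ht hst
  rwa [← hA.lt_iff_lt (hmem hs) (hmem ht), hinv hs, hinv ht]

lemma invFunOn_Ici_pos (hA : StrictMonoOn A (Ici 0)) (hAbij : BijOn A (Ici 0) (Ici 0))
    {t : ℝ} (ht : 0 < t) : 0 < Function.invFunOn A (Ici 0) t :=
  (hAbij.surjOn.mapsTo_invFunOn (mem_Ici.2 le_rfl)).trans_lt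
    (strictMonoOn_invFunOn_Ici hA hAbij (mem_Ici.2 le_rfl) ht.le ht)

end InverseFunction

/-- Theorem 2.6 (interpolation in the Orlicz scale): if the sublinear operator `T` maps
`L^{p₀,1} → L^{p₀,∞}` and `L^∞ → L^∞`, and the strictly increasing bijection `A` of `[0,∞)`
satisfies `∫_s^∞ (1/A⁻¹(1/t)) t^{-1/p₀} dt/t ≤ κ s^{-1/p₀}/A⁻¹(1/s)` for all `s > 0`,
then `‖Tf‖_{L^{A,1}} ≤ 2(C₁ + C₀κ)‖f‖_{L^{A,1}}`. -/
theorem orlicz_scale_interpolation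
    {X : Type*} [MeasurableSpace X] (μ : Measure X) [SigmaFinite μ]
    (p₀ : ℝ) (hp₀ : 1 ≤ p₀)
    (T : (X → ℝ) → (X → ℝ))
    (hsub : ∀ g h : X → ℝ, ∀ᵐ x ∂μ, |T (g + h) x| ≤ |T g x| + |T h x|)
    (C₀ C₁ : ℝ) (hC₀ : 0 ≤ C₀) (hC₁ : 0 ≤ C₁)
    (hT₀ : ∀ f : X → ℝ, lorentzWeakNorm p₀ μ (T f) ≤ ENNReal.ofReal C₀ * lorentz1Norm p₀ μ f)
    (hT₁ : ∀ f : X → ℝ, eLpNorm (T f) ⊤ μ ≤ ENNReal.ofReal C₁ * eLpNorm f ⊤ μ)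
    (A : ℝ → ℝ) (hA : StrictMonoOn A (Set.Ici 0)) (hAbij : Set.BijOn A (Set.Ici 0) (Set.Ici 0))
    (κ : ℝ) (hκ : 1 < κ)
    (hint : ∀ s : ℝ, 0 < s →
      (∫⁻ t in Set.Ioi s,
          ENNReal.ofReal ((1 / Function.invFunOn A (Set.Ici 0) (1 / t)) * t ^ (-1 / p₀) / t)) ≤
        ENNReal.ofReal (κ * s ^ (-1 / p₀) / Function.invFunOn A (Set.Ici 0) (1 / s))) :
    ∀ f : X → ℝ, orliczLorentz1Norm (Function.invFunOn A (Set.Ici 0)) μ f < ⊤ →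
      orliczLorentz1Norm (Function.invFunOn A (Set.Ici 0)) μ (T f) ≤
        ENNReal.ofReal (2 * (C₁ + C₀ * κ)) *
          orliczLorentz1Norm (Function.invFunOn A (Set.Ici 0)) μ f := by
  intro f hf
  have hκ0 : 0 ≤ κ := by linarith
  refine (orliczLorentz1Norm_sublinear_le hsub hC₀ hC₁ hT₀ hT₁
    ((strictMonoOn_invFunOn_Ici hA hAbij).monotoneOn.mono Ioi_subset_Ici_self)
    (fun t ht => invFunOn_Ici_pos hA hAbij ht) hκ0 hint hf).trans ?_
  gcongr
  linarith [mul_nonneg hC₀ hκ0]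

end
end

section
/- Let u ∈ A_1 and v ∈ A_∞. Then there exists p_0 with 1 < p_0 < ∞ such that u^{1-p_0} v ∈ A_{p_0}. Moreover, if v ∈ A_t with t>1 and ε_0 ∈ (0,1) is such that u w^ε ∈ A_1 for every w ∈ A_1 and every 0<ε<ε_0, then one may take p_0 = 2(t-1)/ε_0 + 1. -/
open MeasureTheory Set
open scoped ENNReal

noncomputable section

/-- A cube in `ℝⁿ` with center `c` and half side length `r`. -/
def cube {n : ℕ} (c : Fin n → ℝ) (r : ℝ) : Set (Fin n → ℝ) := {y | ∀ i, |y i - c i| ≤ r}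

/-- The (uncentered) Hardy–Littlewood maximal operator over cubes. -/
def maximal {n : ℕ} (f : (Fin n → ℝ) → ℝ) (x : Fin n → ℝ) : ℝ≥0∞ :=
  ⨆ (c : Fin n → ℝ) (r : ℝ) (_ : 0 < r) (_ : x ∈ cube c r),
    (volume (cube c r))⁻¹ * ∫⁻ y in cube c r, ENNReal.ofReal |f y|

/-- A weight: a locally integrable a.e.-positive function on `ℝⁿ`. -/
def IsWeight {n : ℕ} (w : (Fin n → ℝ) → ℝ) : Prop :=
  LocallyIntegrable w volume ∧ ∀ᵐ x, 0 < w x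

/-- The `A₁` constant `‖Mw/w‖_{L^∞}`. -/
def A1const {n : ℕ} (w : (Fin n → ℝ) → ℝ) : ℝ≥0∞ :=
  essSup (fun x => maximal w x / ENNReal.ofReal (w x)) volume

def MemA1 {n : ℕ} (w : (Fin n → ℝ) → ℝ) : Prop :=
  IsWeight w ∧ A1const w < ⊤

/-- The `A_p` constant, `1 < p < ∞`. -/
def ApConst {n : ℕ} (p : ℝ) (w : (Fin n → ℝ) → ℝ) : ℝ≥0∞ :=
  ⨆ (c : Fin n → ℝ) (r : ℝ) (_ : 0 < r),
    ((volume (cube c r))⁻¹ * ∫⁻ y in cube c r, ENNReal.ofReal (w y)) *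
      ((volume (cube c r))⁻¹ * ∫⁻ y in cube c r,
          ENNReal.ofReal (w y ^ (-1 / (p - 1)))) ^ (p - 1)

def MemAp {n : ℕ} (p : ℝ) (w : (Fin n → ℝ) → ℝ) : Prop :=
  IsWeight w ∧ ApConst p w < ⊤

/-- `A_∞ = ⋃_{p ≥ 1} A_p`. -/
def MemAinfty {n : ℕ} (w : (Fin n → ℝ) → ℝ) : Prop :=
  MemA1 w ∨ ∃ p : ℝ, 1 < p ∧ MemAp p w

/-- The measure with density `u·v` with respect to Lebesgue measure. -/
def wMeasure {n : ℕ} (u v : (Fin n → ℝ) → ℝ) : Measure (Fin n → ℝ) :=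
  volume.withDensity (fun x => ENNReal.ofReal (u x * v x))

theorem cube_eq_closedBall {n : ℕ} (c : Fin n → ℝ) {r : ℝ} (hr : 0 ≤ r) :
    cube c r = Metric.closedBall c r := by
  ext y
  simp [cube, dist_pi_le_iff hr, Real.dist_eq]

theorem volume_closedBall_mul {n : ℕ} (x y : Fin n → ℝ) {k r : ℝ} (hk : 0 ≤ k) (hr : 0 ≤ r) :
    volume (Metric.closedBall x (k * r)) =
      ENNReal.ofReal (k ^ n) * volume (Metric.closedBall y r) := by
  rw [Real.volume_pi_closedBall _ (by positivity), Real.volume_pi_closedBall _ hr,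
    ← ENNReal.ofReal_mul (by positivity), Fintype.card_fin, ← mul_pow]
  ring_nf

theorem volume_closedBall_ne_zero {n : ℕ} (x : Fin n → ℝ) {r : ℝ} (hr : 0 < r) :
    volume (Metric.closedBall x r) ≠ 0 :=
  (Metric.measure_closedBall_pos volume x hr).ne'

theorem volume_closedBall_ne_top {n : ℕ} (x : Fin n → ℝ) (r : ℝ) :
    volume (Metric.closedBall x r) ≠ ⊤ := measure_closedBall_lt_top.ne

/-- A cube centred in a larger cube `Q` has a fixed fraction of its volume inside `Q`. -/
theorem volume_closedBall_le_inter {n : ℕ} {x c : Fin n → ℝ} {r R : ℝ} (hr : 0 < r)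
    (hrR : r ≤ R) (hx : x ∈ Metric.closedBall c R) :
    volume (Metric.closedBall x r) ≤
      ENNReal.ofReal (2 ^ n) * volume (Metric.closedBall x r ∩ Metric.closedBall c R) := by
  have hR : 0 < R := hr.trans_le hrR
  set s : ℝ := r / (2 * R)
  have hs : s * R = r / 2 := by simp only [s]; field_simp
  have hs0 : 0 ≤ s := by positivity
  have hs1 : s ≤ 1 := by
    rw [div_le_one (by positivity)]; linarith
  have hxc : ‖c - x‖ ≤ R := by
    rw [← dist_eq_norm, dist_comm]; exact hx
  set y : Fin n → ℝ := x + s • (c - x) with hy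
  have hyx : dist y x ≤ r / 2 := by
    rw [dist_eq_norm, hy, add_sub_cancel_left, norm_smul, Real.norm_of_nonneg hs0, ← hs]
    gcongr
  have hyc : dist y c ≤ R - r / 2 := by
    have : y - c = (s - 1) • (c - x) := by rw [hy]; module
    rw [dist_eq_norm, this, norm_smul, Real.norm_of_nonpos (by linarith), ← hs]
    nlinarith
  calc volume (Metric.closedBall x r) = volume (Metric.closedBall x (2 * (r / 2))) := by
        ring_nf
    _ = ENNReal.ofReal (2 ^ n) * volume (Metric.closedBall y (r / 2)) :=
        volume_closedBall_mul _ _ (by norm_num) (by positivity)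
    _ ≤ _ := by
        gcongr
        exact subset_inter (Metric.closedBall_subset_closedBall' (by linarith))
          (Metric.closedBall_subset_closedBall' (by linarith))

theorem MemA1.exists_average_le {n : ℕ} {u : (Fin n → ℝ) → ℝ} (hu : MemA1 u) :
    ∃ C : ℝ, 1 ≤ C ∧ ∀ᵐ x, ∀ c r, 0 < r → x ∈ Metric.closedBall c r →
      (volume (Metric.closedBall c r))⁻¹ *
        ∫⁻ y in Metric.closedBall c r, ENNReal.ofReal (u y) ≤
          ENNReal.ofReal C * ENNReal.ofReal (u x) := by
  refine ⟨max 1 (A1const u).toReal, le_max_left _ _, ?_⟩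
  filter_upwards [hu.1.2, ENNReal.ae_le_essSup
    (fun x => maximal u x / ENNReal.ofReal (u x))] with x hx hle c r hr hxc
  have hM : maximal u x ≤ A1const u * ENNReal.ofReal (u x) :=
    (ENNReal.div_le_iff (by simpa using hx) ENNReal.ofReal_ne_top).1 hle
  calc _ ≤ (volume (cube c r))⁻¹ * ∫⁻ y in cube c r, ENNReal.ofReal |u y| := by
        rw [cube_eq_closedBall c hr.le]
        gcongr with y
        exact le_abs_self _
    _ ≤ maximal u x := by
        refine le_iSup_of_le c (le_iSup_of_le r (le_iSup_of_le hr (le_iSup_of_le ?_ le_rfl)))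
        rwa [cube_eq_closedBall c hr.le]
    _ ≤ _ := by
        refine hM.trans ?_
        gcongr
        rw [← ENNReal.ofReal_toReal hu.2.ne]
        exact ENNReal.ofReal_le_ofReal (by rw [ENNReal.ofReal_toReal hu.2.ne]; exact le_max_right _ _)

theorem exists_stopping_radius {n : ℕ} {U : (Fin n → ℝ) → ℝ≥0∞} {c : Fin n → ℝ} {R : ℝ}
    {l : ℝ≥0∞} (hR : 0 < R)
    (hl : ∫⁻ y in Metric.closedBall c R, U y < l * volume (Metric.closedBall c R))
    {x : Fin n → ℝ} {f : ℝ → ℝ≥0∞} (hf : ∀ r, f r ≤ ∫⁻ y in Metric.closedBall c R, U y)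
    (hx : ∃ r, 0 < r ∧ l * volume (Metric.closedBall x r) ≤ f r) :
    ∃ r, 0 < r ∧ r ≤ R ∧ l * volume (Metric.closedBall x r) ≤ f r ∧
      f (5 * r) ≤ l * volume (Metric.closedBall x (5 * r)) := by
  set S : Set ℝ := {r | 0 < r ∧ l * volume (Metric.closedBall x r) ≤ f r}
  have hS : ∀ r ∈ S, r ≤ R := by
    rintro r ⟨hr, h⟩
    by_contra! hlt
    refine absurd (h.trans (hf r)) (not_le.2 (hl.trans_le ?_))
    gcongr l * ?_
    rw [Real.volume_pi_closedBall _ hR.le, Real.volume_pi_closedBall _ hr.le]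
    gcongr
  have hbdd : BddAbove S := ⟨R, hS⟩
  obtain ⟨r₀, hr₀⟩ : S.Nonempty := hx
  have hpos : 0 < sSup S := hr₀.1.trans_le (le_csSup hbdd hr₀)
  obtain ⟨r, hr, hlt⟩ := exists_lt_of_lt_csSup ⟨r₀, hr₀⟩ (half_lt_self hpos)
  refine ⟨r, hr.1, hS r hr, hr.2, ?_⟩
  by_contra! h
  have := le_csSup hbdd (show 5 * r ∈ S from ⟨by linarith [hr.1], h.le⟩)
  linarith

/-- Weighted good-`λ` estimate for the level sets of a function satisfying the `A₁` condition. -/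
theorem lintegral_superlevel_le {n : ℕ} {U : (Fin n → ℝ) → ℝ≥0∞} (hU : AEMeasurable U)
    {K : ℝ≥0∞} (hK : ∀ᵐ x, ∀ c r, 0 < r → x ∈ Metric.closedBall c r →
      (volume (Metric.closedBall c r))⁻¹ * ∫⁻ y in Metric.closedBall c r, U y ≤ K * U x)
    {c : Fin n → ℝ} {R : ℝ} (hR : 0 < R) {l : ℝ≥0∞}
    (hl : ∫⁻ y in Metric.closedBall c R, U y < l * volume (Metric.closedBall c R)) :
    ∫⁻ y in Metric.closedBall c R ∩ {x | l < U x}, U y ≤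
      ENNReal.ofReal (10 ^ n) * l * volume (Metric.closedBall c R ∩ {x | l ≤ K * U x}) := by
  set Q := Metric.closedBall c R with hQ
  have hQm : MeasurableSet Q := Metric.isClosed_closedBall.measurableSet
  set F : (Fin n → ℝ) → ℝ → ℝ≥0∞ := fun x r => ∫⁻ y in Metric.closedBall x r, Q.indicator U y
    with hF
  have hFle : ∀ x r, F x r ≤ ∫⁻ y in Q, U y := fun x r => by
    rw [← lintegral_indicator hQm]
    exact setLIntegral_le_lintegral _ _
  have hdiff : ∀ᵐ x, x ∈ Q → l < U x →
      ∃ r, 0 < r ∧ l * volume (Metric.closedBall x r) ≤ F x r := by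
    have hfin : ∫⁻ y, Q.indicator U y ≠ ⊤ := by
      rw [lintegral_indicator hQm]
      exact hl.ne_top
    filter_upwards [(Besicovitch.vitaliFamily
      (volume : Measure (Fin n → ℝ))).ae_tendsto_lintegral_div (hU.indicator hQm) hfin]
      with x hx hxQ hlx
    rw [indicator_of_mem hxQ] at hx
    have h := (hx.comp (Besicovitch.tendsto_filterAt volume x)).eventually (lt_mem_nhds hlx)
    obtain ⟨r, h1, h2⟩ := (h.and self_mem_nhdsWithin).exists
    refine ⟨r, h2, ?_⟩
    exact ((ENNReal.le_div_iff_mul_le (.inl (volume_closedBall_ne_zero x h2))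
      (.inl (volume_closedBall_ne_top x r))).1 h1.le)
  set G : Set (Fin n → ℝ) :=
    {x | x ∈ Q ∧ ∃ r, 0 < r ∧ l * volume (Metric.closedBall x r) ≤ F x r} with hG
  have hradius : ∀ x : Fin n → ℝ, ∃ r, x ∈ G →
      0 < r ∧ r ≤ R ∧ l * volume (Metric.closedBall x r) ≤ F x r ∧
        F x (5 * r) ≤ l * volume (Metric.closedBall x (5 * r)) := fun x => by
    by_cases hx : x ∈ G
    · obtain ⟨r, hr⟩ := exists_stopping_radius hR hl (hFle x) hx.2
      exact ⟨r, fun _ => hr⟩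
    · exact ⟨0, fun h => absurd h hx⟩
  choose ρ hρ using hradius
  obtain ⟨J, hJG, hJd, hJc⟩ := Vitali.exists_disjoint_subfamily_covering_enlargement_closedBall
    G id ρ R (fun x hx => (hρ x hx).2.1) 5 (by norm_num)
  simp only [id] at hJd hJc
  have hJcount : J.Countable := hJd.countable_of_nonempty_interior fun x hx =>
    ⟨x, Metric.ball_subset_interior_closedBall (Metric.mem_ball_self (hρ x (hJG hx)).1)⟩
  set P : Set (Fin n → ℝ) := Q ∩ {x | l ≤ K * U x} with hP
  have hball : ∀ x ∈ J, F x (5 * ρ x) ≤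
      ENNReal.ofReal (10 ^ n) * l * volume.restrict P (Metric.closedBall x (ρ x)) := by
    intro x hx
    obtain ⟨h0, hle, h1, h2⟩ := hρ x (hJG hx)
    have hlow : ∀ᵐ y, y ∈ Metric.closedBall x (ρ x) → l ≤ K * U y := by
      filter_upwards [hK] with y hy hyB
      refine le_trans ?_ (hy x (ρ x) h0 hyB)
      have hav : l ≤ (volume (Metric.closedBall x (ρ x)))⁻¹ * F x (ρ x) := by
        rw [mul_comm, ← div_eq_mul_inv]
        exact (ENNReal.le_div_iff_mul_le (.inl (volume_closedBall_ne_zero x h0))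
          (.inl (volume_closedBall_ne_top x _))).2 h1
      refine hav.trans ?_
      gcongr
      exact lintegral_mono (indicator_le_self _ _)
    have hvol : volume (Metric.closedBall x (ρ x) ∩ Q) ≤
        volume.restrict P (Metric.closedBall x (ρ x)) := by
      rw [Measure.restrict_apply Metric.isClosed_closedBall.measurableSet]
      refine measure_mono_ae ?_
      filter_upwards [hlow] with y hy hyB
      exact ⟨hyB.1, hyB.2, hy hyB.1⟩
    calc F x (5 * ρ x) ≤ l * volume (Metric.closedBall x (5 * ρ x)) := h2
      _ = ENNReal.ofReal (5 ^ n) * l * volume (Metric.closedBall x (ρ x)) := by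
          rw [volume_closedBall_mul x x (by norm_num) h0.le]; ring
      _ ≤ ENNReal.ofReal (5 ^ n) * l *
          (ENNReal.ofReal (2 ^ n) * volume (Metric.closedBall x (ρ x) ∩ Q)) := by
          gcongr
          exact volume_closedBall_le_inter h0 hle (hJG hx).1
      _ = ENNReal.ofReal (10 ^ n) * l * volume (Metric.closedBall x (ρ x) ∩ Q) := by
          rw [show (10 : ℝ) ^ n = 5 ^ n * 2 ^ n by rw [← mul_pow]; norm_num,
            ENNReal.ofReal_mul (by positivity)]
          ring
      _ ≤ _ := by gcongr
  have hcover : ∀ᵐ y, y ∈ Q ∩ {x | l < U x} →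
      y ∈ (⋃ x ∈ J, Metric.closedBall x (5 * ρ x)) ∩ Q := by
    filter_upwards [hdiff] with y hy hyQ
    have hyG : y ∈ G := ⟨hyQ.1, hy hyQ.1 hyQ.2⟩
    obtain ⟨x, hx, hsub⟩ := hJc y hyG
    exact ⟨mem_biUnion hx (hsub (Metric.mem_closedBall_self (hρ y hyG).1.le)), hyQ.1⟩
  calc ∫⁻ y in Q ∩ {x | l < U x}, U y
      ≤ ∫⁻ y in (⋃ x ∈ J, Metric.closedBall x (5 * ρ x)) ∩ Q, U y :=
        lintegral_mono' (Measure.restrict_mono_ae hcover) le_rfl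
    _ = ∫⁻ y in ⋃ x ∈ J, Metric.closedBall x (5 * ρ x), Q.indicator U y := by
        rw [setLIntegral_indicator hQm, inter_comm]
    _ = ∫⁻ y in ⋃ x : J, Metric.closedBall (x : Fin n → ℝ) (5 * ρ x), Q.indicator U y := by
        rw [biUnion_eq_iUnion]
    _ ≤ ∑' x : J, F x (5 * ρ x) := by
        have := hJcount.to_subtype
        exact lintegral_iUnion_le _ _
    _ ≤ ∑' x : J, ENNReal.ofReal (10 ^ n) * l *
          volume.restrict P (Metric.closedBall (x : Fin n → ℝ) (ρ x)) :=
        ENNReal.tsum_le_tsum fun x => hball x x.2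
    _ = ENNReal.ofReal (10 ^ n) * l *
          volume.restrict P (⋃ x ∈ J, Metric.closedBall x (ρ x)) := by
        rw [ENNReal.tsum_mul_left, measure_biUnion hJcount hJd
          (fun x _ => Metric.isClosed_closedBall.measurableSet)]
    _ ≤ ENNReal.ofReal (10 ^ n) * l * volume P := by
        exact mul_le_mul' le_rfl
          ((measure_mono (subset_univ _)).trans_eq (Measure.restrict_apply_univ P))

theorem lintegral_mul_min_rpow_le {n : ℕ} {u : (Fin n → ℝ) → ℝ} (hum : AEMeasurable u)
    (hu0 : ∀ᵐ x, 0 < u x) {C : ℝ} (hC1 : 1 ≤ C)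
    (hC : ∀ᵐ x, ∀ c r, 0 < r → x ∈ Metric.closedBall c r →
      (volume (Metric.closedBall c r))⁻¹ *
        ∫⁻ y in Metric.closedBall c r, ENNReal.ofReal (u y) ≤
          ENNReal.ofReal C * ENNReal.ofReal (u x))
    {c : Fin n → ℝ} {R : ℝ} (hR : 0 < R)
    (hfin : ∫⁻ y in Metric.closedBall c R, ENNReal.ofReal (u y) ≠ ⊤)
    {δ : ℝ} (hδ0 : 0 < δ) (hδ1 : δ ≤ 1) (hδ : 10 ^ n * δ * C ^ 2 ≤ 1 / 2)
    {N : ℝ} (hN : 0 < N) :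
    ∫⁻ y in Metric.closedBall c R, ENNReal.ofReal (u y) * ENNReal.ofReal (min (u y) N ^ δ) ≤
      2 * (((volume (Metric.closedBall c R))⁻¹ *
        ∫⁻ y in Metric.closedBall c R, ENNReal.ofReal (u y)) ^ δ *
        ∫⁻ y in Metric.closedBall c R, ENNReal.ofReal (u y)) := by
  set Q := Metric.closedBall c R with hQ
  have hQm : MeasurableSet Q := Metric.isClosed_closedBall.measurableSet
  set μ : Measure (Fin n → ℝ) := volume.restrict Q with hμ
  have hμle : ∀ {p : (Fin n → ℝ) → Prop}, (∀ᵐ x, p x) → ∀ᵐ x ∂μ, p x := fun h =>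
    ae_restrict_of_ae h
  set U : (Fin n → ℝ) → ℝ≥0∞ := fun x => ENNReal.ofReal (u x) with hUdef
  have hUm : AEMeasurable U := hum.ennreal_ofReal
  set ν : Measure (Fin n → ℝ) := μ.withDensity U with hν
  set A : ℝ≥0∞ := (volume Q)⁻¹ * ∫⁻ y in Q, U y with hA
  have hAtop : A ≠ ⊤ :=
    ENNReal.mul_ne_top (ENNReal.inv_ne_top.2 (volume_closedBall_ne_zero c hR)) hfin
  set f : (Fin n → ℝ) → ℝ := fun x => min (u x) N with hf
  have hfm : AEMeasurable f := hum.min aemeasurable_const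
  have hf0 : ∀ᵐ x, 0 < f x := by
    filter_upwards [hu0] with x hx using lt_min hx hN
  have hνuniv : ν univ = ∫⁻ y in Q, U y := by
    rw [hν, withDensity_apply' _, Measure.restrict_univ]
  have hνμ : ν ≪ μ := withDensity_absolutelyContinuous _ _
  have hlevel : ∀ t : ℝ, 0 < t → ν {x | t < f x} ≤
      ν {_x | t ≤ A.toReal} + ENNReal.ofReal (10 ^ n) * ENNReal.ofReal t *
        μ {x | t ≤ C * f x} := by
    intro t ht
    rcases le_or_gt t A.toReal with h | h
    · exact le_add_right (measure_mono fun x _ => h)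
    rcases le_or_gt N t with hNt | hNt
    · have : {x | t < f x} = ∅ := by
        ext x
        simpa [f] using fun _ => hNt
      simp [this]
    refine le_add_left ?_
    have hlt : ∫⁻ y in Q, U y < ENNReal.ofReal t * volume Q := by
      have : A < ENNReal.ofReal t := (ENNReal.lt_ofReal_iff_toReal_lt hAtop).2 h
      rwa [hA, mul_comm, ← div_eq_mul_inv,
        ENNReal.div_lt_iff (.inl (volume_closedBall_ne_zero c hR))
          (.inl (volume_closedBall_ne_top c R))] at this
    calc ν {x | t < f x} = ∫⁻ y in {x | t < f x} ∩ Q, U y := by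
          rw [hν, withDensity_apply' _, hμ, Measure.restrict_restrict' hQm]
      _ ≤ ∫⁻ y in Q ∩ {x | ENNReal.ofReal t < U x}, U y := by
          refine lintegral_mono_set fun x hx => ⟨hx.2, ?_⟩
          exact (ENNReal.ofReal_lt_ofReal_iff_of_nonneg ht.le).2 (lt_min_iff.1 hx.1).1
      _ ≤ ENNReal.ofReal (10 ^ n) * ENNReal.ofReal t *
          volume (Q ∩ {x | ENNReal.ofReal t ≤ ENNReal.ofReal C * U x}) :=
          lintegral_superlevel_le hUm hC hR hlt
      _ ≤ _ := by
          rw [hμ, Measure.restrict_apply' hQm]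
          refine mul_le_mul' le_rfl (measure_mono fun x hx' => ?_)
          refine ⟨?_, hx'.1⟩
          have hx := hx'.2
          simp only [mem_ofPred_eq, U] at hx ⊢
          rw [← ENNReal.ofReal_mul (by linarith)] at hx
          have hx' : t ≤ C * u x := by
            rcases ENNReal.ofReal_le_ofReal_iff'.1 hx with h | h
            · exact h
            · linarith
          rw [hf, mul_min_of_nonneg _ _ (by linarith)]
          exact le_min hx' (by nlinarith)
  set I : ℝ≥0∞ := ∫⁻ y in Q, U y * ENNReal.ofReal (f y ^ δ) with hI
  have hIν : I = ∫⁻ y, ENNReal.ofReal (f y ^ δ) ∂ν := by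
    rw [hI, hν, lintegral_withDensity_eq_lintegral_mul₀ hUm.restrict
      (hfm.restrict.pow_const δ).ennreal_ofReal]
    rfl
  have hItop : I ≠ ⊤ := by
    refine ne_top_of_le_ne_top
      (ENNReal.mul_ne_top (ENNReal.ofReal_ne_top (r := N ^ δ)) hfin) ?_
    rw [← lintegral_const_mul'' _ hUm.restrict]
    refine lintegral_mono_ae ?_
    filter_upwards [hμle hf0] with x hx
    rw [mul_comm]
    gcongr
    exact min_le_right _ _
  have hpow : ∫⁻ y, ENNReal.ofReal ((C * f y) ^ (1 + δ)) ∂μ ≤ ENNReal.ofReal (C ^ 2) * I := by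
    rw [hI, ← lintegral_const_mul' _ _ ENNReal.ofReal_ne_top]
    refine lintegral_mono_ae ?_
    filter_upwards [hμle hf0] with x hx
    rw [← ENNReal.ofReal_mul' (by positivity), ← ENNReal.ofReal_mul (by positivity)]
    refine ENNReal.ofReal_le_ofReal ?_
    rw [Real.mul_rpow (by linarith) hx.le, Real.rpow_add hx, Real.rpow_one]
    gcongr
    · rw [← Real.rpow_natCast]
      exact Real.rpow_le_rpow_of_exponent_le hC1 (by push_cast; linarith)
    · exact min_le_left _ _
  have hmeas : Measurable fun t : ℝ =>
      ν {_x | t ≤ A.toReal} * ENNReal.ofReal (t ^ (δ - 1)) := by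
    refine Measurable.mul (Antitone.measurable fun s t hst => ?_) (by fun_prop)
    exact measure_mono fun x hx => hst.trans hx
  have hsum : I ≤ A ^ δ * (∫⁻ y in Q, U y) + ENNReal.ofReal (1 / 2) * I := by
    calc I = ENNReal.ofReal δ *
          ∫⁻ t in Ioi 0, ν {x | t < f x} * ENNReal.ofReal (t ^ (δ - 1)) := by
          rw [hIν, lintegral_rpow_eq_lintegral_meas_lt_mul ν
            (hνμ.ae_le ((hμle hf0).mono fun x hx => hx.le)) (hfm.restrict.mono_ac hνμ) hδ0]
      _ ≤ ENNReal.ofReal δ * ∫⁻ t in Ioi 0, (ν {_x | t ≤ A.toReal} *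
            ENNReal.ofReal (t ^ (δ - 1)) + ENNReal.ofReal (10 ^ n) *
              (μ {x | t ≤ C * f x} * ENNReal.ofReal (t ^ (1 + δ - 1)))) := by
          refine mul_le_mul' le_rfl ?_
          refine setLIntegral_mono' measurableSet_Ioi fun t ht => ?_
          refine (mul_le_mul' (hlevel t ht) le_rfl).trans_eq ?_
          rw [add_mul, show 1 + δ - 1 = 1 + (δ - 1) by ring, Real.rpow_add ht, Real.rpow_one,
            ENNReal.ofReal_mul (le_of_lt ht)]
          ring
      _ = ENNReal.ofReal δ * (∫⁻ t in Ioi 0, ν {_x | t ≤ A.toReal} *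
            ENNReal.ofReal (t ^ (δ - 1))) + ENNReal.ofReal (10 ^ n * δ) *
              ∫⁻ t in Ioi 0, (μ {x | t ≤ C * f x} * ENNReal.ofReal (t ^ (1 + δ - 1))) := by
          rw [lintegral_add_left hmeas, lintegral_const_mul' _ _ ENNReal.ofReal_ne_top,
            mul_add, ENNReal.ofReal_mul (by positivity)]
          ring
      _ ≤ A ^ δ * (∫⁻ y in Q, U y) + ENNReal.ofReal (10 ^ n * δ) *
            ∫⁻ y, ENNReal.ofReal ((C * f y) ^ (1 + δ)) ∂μ := by
          gcongr ?_ + _ * ?_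
          · rw [← lintegral_rpow_eq_lintegral_meas_le_mul ν
              (f := fun _ => A.toReal) (by filter_upwards with x using ENNReal.toReal_nonneg)
              aemeasurable_const hδ0, lintegral_const, hνuniv,
              ← ENNReal.ofReal_rpow_of_nonneg ENNReal.toReal_nonneg hδ0.le,
              ENNReal.ofReal_toReal hAtop]
          · rw [lintegral_rpow_eq_lintegral_meas_le_mul μ
              ((hμle hf0).mono fun x hx => by simp only [Pi.zero_apply]; positivity)
              (hfm.restrict.const_mul C) (by linarith : 0 < 1 + δ)]
            refine le_mul_of_one_le_left' ?_
            rw [ENNReal.one_le_ofReal]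
            linarith
      _ ≤ A ^ δ * (∫⁻ y in Q, U y) + ENNReal.ofReal (10 ^ n * δ) *
            (ENNReal.ofReal (C ^ 2) * I) := by gcongr
      _ ≤ _ := by
          rw [← mul_assoc, ← ENNReal.ofReal_mul (by positivity)]
          gcongr
  have hhalf : ENNReal.ofReal (1 / 2) * I + ENNReal.ofReal (1 / 2) * I = I := by
    rw [← add_mul, ← ENNReal.ofReal_add (by norm_num) (by norm_num)]
    norm_num
  have hle : ENNReal.ofReal (1 / 2) * I ≤ A ^ δ * (∫⁻ y in Q, U y) := by
    refine (ENNReal.add_le_add_iff_right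
      (ENNReal.mul_ne_top (ENNReal.ofReal_ne_top (r := 1 / 2)) hItop)).1 ?_
    rw [hhalf]
    exact hsum
  calc I = ENNReal.ofReal (1 / 2) * I + ENNReal.ofReal (1 / 2) * I := hhalf.symm
    _ ≤ _ := by
      rw [← two_mul]
      gcongr

/-- `u` satisfies `avg_Q u^s ≤ K · (ess inf_Q u)^s` uniformly over cubes `Q`. -/
def ReverseHolderA1 {n : ℕ} (s : ℝ) (u : (Fin n → ℝ) → ℝ) : Prop :=
  ∃ K : ℝ≥0∞, K ≠ ⊤ ∧ ∀ᵐ x, ∀ c r, 0 < r → x ∈ Metric.closedBall c r →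
    (volume (Metric.closedBall c r))⁻¹ *
      ∫⁻ y in Metric.closedBall c r, ENNReal.ofReal (u y) ^ s ≤ K * ENNReal.ofReal (u x) ^ s

theorem IsWeight.lintegral_closedBall_ne_top {n : ℕ} {w : (Fin n → ℝ) → ℝ} (hw : IsWeight w)
    (c : Fin n → ℝ) (r : ℝ) : ∫⁻ y in Metric.closedBall c r, ENNReal.ofReal (w y) ≠ ⊤ :=
  (hw.1.integrableOn_isCompact (isCompact_closedBall c r)).lintegral_lt_top.ne

theorem IsWeight.aemeasurable {n : ℕ} {w : (Fin n → ℝ) → ℝ} (hw : IsWeight w) :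
    AEMeasurable w := hw.1.aestronglyMeasurable.aemeasurable

/-- `A₁` weights satisfy a reverse Hölder inequality. -/
theorem MemA1.exists_reverseHolder {n : ℕ} {u : (Fin n → ℝ) → ℝ} (hu : MemA1 u) :
    ∃ s : ℝ, 1 < s ∧ ReverseHolderA1 s u := by
  obtain ⟨C, hC1, hC⟩ := hu.exists_average_le
  have hu0 := hu.1.2
  have hum := hu.1.aemeasurable
  set δ : ℝ := 1 / (2 * 10 ^ n * C ^ 2) with hδdef
  have hC0 : 0 < C := by linarith
  have hδ0 : 0 < δ := by positivity
  have hδ : 10 ^ n * δ * C ^ 2 ≤ 1 / 2 := by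
    rw [hδdef]; field_simp; exact le_rfl
  have hδ1 : δ ≤ 1 := by
    have h1 : (1 : ℝ) ≤ 10 ^ n := one_le_pow₀ (by norm_num)
    have h2 : (1 : ℝ) ≤ C ^ 2 := one_le_pow₀ hC1
    nlinarith [mul_le_mul h1 h2 zero_le_one (by positivity)]
  refine ⟨1 + δ, by linarith, 2 * ENNReal.ofReal C ^ (1 + δ),
    ENNReal.mul_ne_top (by norm_num)
      (ENNReal.rpow_ne_top_of_nonneg (by linarith) ENNReal.ofReal_ne_top), ?_⟩
  filter_upwards [hC] with x hx c R hR hxc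
  have hfin := hu.1.lintegral_closedBall_ne_top c R
  set Q := Metric.closedBall c R
  set A : ℝ≥0∞ := (volume Q)⁻¹ * ∫⁻ y in Q, ENNReal.ofReal (u y) with hA
  have hbound : ∀ N : ℕ, ∫⁻ y in Q, ENNReal.ofReal (u y) *
      ENNReal.ofReal (min (u y) (N + 1 : ℕ) ^ δ) ≤
        2 * (A ^ δ * ∫⁻ y in Q, ENNReal.ofReal (u y)) := fun N =>
    lintegral_mul_min_rpow_le hum hu0 hC1 hC hR hfin hδ0 hδ1 hδ (by positivity)
  have hlim : ∫⁻ y in Q, ENNReal.ofReal (u y) ^ (1 + δ) ≤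
      2 * (A ^ δ * ∫⁻ y in Q, ENNReal.ofReal (u y)) := by
    refine le_of_tendsto' (lintegral_tendsto_of_tendsto_of_monotone (fun N => ?_) ?_ ?_) hbound
    · exact (hum.ennreal_ofReal.mul
        ((hum.min aemeasurable_const).pow_const δ).ennreal_ofReal).restrict
    · filter_upwards [ae_restrict_of_ae hu0] with y hy N M hNM
      refine mul_le_mul' le_rfl (ENNReal.ofReal_le_ofReal (Real.rpow_le_rpow
        (le_min hy.le (by positivity)) (min_le_min_left _ ?_) hδ0.le))
      exact_mod_cast Nat.succ_le_succ hNM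
    · filter_upwards [ae_restrict_of_ae hu0] with y hy
      obtain ⟨N, hN⟩ := exists_nat_ge (u y)
      refine tendsto_const_nhds.congr' ?_
      filter_upwards [Filter.eventually_ge_atTop N] with M hM
      have : u y ≤ (M + 1 : ℕ) := hN.trans (by exact_mod_cast hM.trans M.le_succ)
      rw [min_eq_left this, ← ENNReal.ofReal_rpow_of_pos hy,
        ENNReal.rpow_add _ _ (by simpa using hy) ENNReal.ofReal_ne_top, ENNReal.rpow_one]
  calc (volume Q)⁻¹ * ∫⁻ y in Q, ENNReal.ofReal (u y) ^ (1 + δ)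
      ≤ (volume Q)⁻¹ * (2 * (A ^ δ * ∫⁻ y in Q, ENNReal.ofReal (u y))) := by gcongr
    _ = 2 * (A * A ^ δ) := by rw [hA]; ring
    _ = 2 * A ^ (1 + δ) := by
        rw [ENNReal.rpow_add_of_nonneg _ _ zero_le_one hδ0.le, ENNReal.rpow_one]
    _ ≤ 2 * (ENNReal.ofReal C * ENNReal.ofReal (u x)) ^ (1 + δ) := by
        gcongr
        exact hx c R hR hxc
    _ = _ := by rw [ENNReal.mul_rpow_of_nonneg _ _ (by linarith), mul_assoc]

theorem lintegral_cond {α : Type*} [MeasurableSpace α] (μ : Measure α) (s : Set α)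
    (f : α → ℝ≥0∞) :
    ∫⁻ y, f y ∂(ProbabilityTheory.cond μ s) = (μ s)⁻¹ * ∫⁻ y in s, f y ∂μ := by
  rw [ProbabilityTheory.cond, lintegral_smul_measure, smul_eq_mul]

theorem ae_cond_closedBall {n : ℕ} {c : Fin n → ℝ} {r : ℝ} {p : (Fin n → ℝ) → Prop}
    (h : ∀ᵐ x, x ∈ Metric.closedBall c r → p x) :
    ∀ᵐ x ∂(ProbabilityTheory.cond volume (Metric.closedBall c r)), p x :=
  Measure.ae_smul_measure
    ((ae_restrict_iff' Metric.isClosed_closedBall.measurableSet).2 h) _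

theorem isProbabilityMeasure_cond_closedBall {n : ℕ} (c : Fin n → ℝ) {r : ℝ} (hr : 0 < r) :
    IsProbabilityMeasure
      (ProbabilityTheory.cond (volume : Measure (Fin n → ℝ)) (Metric.closedBall c r)) :=
  ProbabilityTheory.cond_isProbabilityMeasure_of_finite (volume_closedBall_ne_zero c hr)
    (volume_closedBall_ne_top c r)

theorem ApConst_eq {n : ℕ} (p : ℝ) (w : (Fin n → ℝ) → ℝ) :
    ApConst p w = ⨆ (c : Fin n → ℝ) (r : ℝ) (_ : 0 < r),
      (∫⁻ y, ENNReal.ofReal (w y) ∂(ProbabilityTheory.cond volume (Metric.closedBall c r))) *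
        (∫⁻ y, ENNReal.ofReal (w y ^ (-1 / (p - 1)))
          ∂(ProbabilityTheory.cond volume (Metric.closedBall c r))) ^ (p - 1) := by
  unfold ApConst
  refine iSup_congr fun c => iSup_congr fun r => iSup_congr fun hr => ?_
  rw [lintegral_cond, lintegral_cond, cube_eq_closedBall c hr.le]

theorem lintegral_rpow_le_of_exponent_le {α : Type*} [MeasurableSpace α] {μ : Measure α}
    [IsProbabilityMeasure μ] {f : α → ℝ≥0∞} (hf : AEMeasurable f μ) {s t : ℝ} (hs : 0 < s)
    (hst : s ≤ t) : ∫⁻ x, f x ^ s ∂μ ≤ (∫⁻ x, f x ^ t ∂μ) ^ (s / t) := by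
  have h := eLpNorm'_le_eLpNorm'_of_exponent_le hs hst μ hf.aestronglyMeasurable
  simp only [eLpNorm', enorm_eq_self] at h
  have h' := ENNReal.rpow_le_rpow h hs.le
  rwa [← ENNReal.rpow_mul, ← ENNReal.rpow_mul, one_div_mul_cancel hs.ne', ENNReal.rpow_one,
    one_div_mul_eq_div] at h'

theorem ReverseHolderA1.mono {n : ℕ} {u : (Fin n → ℝ) → ℝ} (hu : AEMeasurable u) {s t : ℝ}
    (hs : 0 < s) (hst : s ≤ t) (h : ReverseHolderA1 t u) : ReverseHolderA1 s u := by
  obtain ⟨K, hK, h⟩ := h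
  have ht : 0 < t := hs.trans_le hst
  refine ⟨K ^ (s / t), ENNReal.rpow_ne_top_of_nonneg (by positivity) hK, ?_⟩
  filter_upwards [h] with x hx c r hr hxc
  have := isProbabilityMeasure_cond_closedBall c hr
  have hx' := hx c r hr hxc
  rw [← lintegral_cond] at hx' ⊢
  calc _ ≤ _ := lintegral_rpow_le_of_exponent_le
        (hu.ennreal_ofReal.mono_ac ProbabilityTheory.cond_absolutelyContinuous) hs hst
    _ ≤ (K * ENNReal.ofReal (u x) ^ t) ^ (s / t) := by gcongr
    _ = _ := by
        rw [ENNReal.mul_rpow_of_nonneg _ _ (by positivity), ← ENNReal.rpow_mul,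
          mul_div_cancel₀ _ ht.ne']

theorem lintegral_rpow_mul_le {n : ℕ} {u v : (Fin n → ℝ) → ℝ}
    (hu0 : ∀ᵐ x, 0 < u x) {s q : ℝ} (hs : 0 < s) (hq : 0 < q) {K : ℝ≥0∞} (hK : K ≠ ⊤)
    {c : Fin n → ℝ} {r : ℝ} (hK' : ∀ᵐ x, x ∈ Metric.closedBall c r →
      ∫⁻ y, ENNReal.ofReal (u y) ^ s ∂(ProbabilityTheory.cond volume (Metric.closedBall c r)) ≤
        K * ENNReal.ofReal (u x) ^ s) :
    (∫⁻ y, ENNReal.ofReal (u y) ^ s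
        ∂(ProbabilityTheory.cond volume (Metric.closedBall c r))) ^ (q / s) *
      ∫⁻ y, ENNReal.ofReal (u y ^ (-q) * v y)
        ∂(ProbabilityTheory.cond volume (Metric.closedBall c r)) ≤
      K ^ (q / s) * ∫⁻ y, ENNReal.ofReal (v y)
        ∂(ProbabilityTheory.cond volume (Metric.closedBall c r)) := by
  set m := ProbabilityTheory.cond (volume : Measure (Fin n → ℝ)) (Metric.closedBall c r)
  set A := ∫⁻ y, ENNReal.ofReal (u y) ^ s ∂m
  have hqs : 0 < q / s := by positivity
  have hA : ∀ᵐ y ∂m, A ^ (q / s) * ENNReal.ofReal (u y ^ (-q) * v y) ≤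
      K ^ (q / s) * ENNReal.ofReal (v y) := by
    filter_upwards [ae_cond_closedBall hK',
      ProbabilityTheory.cond_absolutelyContinuous.ae_le hu0] with y hy hy0
    have h1 : A ^ (q / s) ≤ K ^ (q / s) * ENNReal.ofReal (u y ^ q) := by
      refine (ENNReal.rpow_le_rpow hy hqs.le).trans_eq ?_
      rw [ENNReal.mul_rpow_of_nonneg _ _ hqs.le, ← ENNReal.rpow_mul, mul_div_cancel₀ _ hs.ne',
        ENNReal.ofReal_rpow_of_pos hy0]
    calc _ ≤ K ^ (q / s) * ENNReal.ofReal (u y ^ q) * ENNReal.ofReal (u y ^ (-q) * v y) := by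
          gcongr
      _ = K ^ (q / s) * ENNReal.ofReal (v y) := by
          rw [mul_assoc, ← ENNReal.ofReal_mul (by positivity), ← mul_assoc,
            ← Real.rpow_add hy0, add_neg_cancel, Real.rpow_zero, one_mul]
  calc _ ≤ ∫⁻ y, A ^ (q / s) * ENNReal.ofReal (u y ^ (-q) * v y) ∂m :=
        lintegral_const_mul_le _ _
    _ ≤ ∫⁻ y, K ^ (q / s) * ENNReal.ofReal (v y) ∂m := lintegral_mono_ae hA
    _ = _ := lintegral_const_mul' _ _ (ENNReal.rpow_ne_top_of_nonneg hqs.le hK)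

theorem lintegral_dual_rpow_le {α : Type*} [MeasurableSpace α] {m : Measure α} {u v : α → ℝ}
    (hu : AEMeasurable u m) (hv : AEMeasurable v m)
    (hu0 : ∀ᵐ x ∂m, 0 < u x) (hv0 : ∀ᵐ x ∂m, 0 < v x)
    {s t q : ℝ} (hs : 1 < s) (ht : 1 < t) (hq : q = (t - 1) * s / (s - 1)) :
    (∫⁻ y, ENNReal.ofReal ((u y ^ (-q) * v y) ^ (-1 / q)) ∂m) ^ q ≤
      (∫⁻ y, ENNReal.ofReal (u y) ^ s ∂m) ^ (q / s) *
        (∫⁻ y, ENNReal.ofReal (v y ^ (-1 / (t - 1))) ∂m) ^ (t - 1) := by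
  have hs1 : 0 < s - 1 := by linarith
  have ht1 : 0 < t - 1 := by linarith
  have hs0 : 0 < s := by linarith
  have hq0 : 0 < q := by rw [hq]; positivity
  set ε : ℝ := (s - 1) / s with hε
  have hε0 : 0 < ε := by positivity
  have hεq : ε * q = t - 1 := by rw [hε, hq]; field_simp
  set S : α → ℝ≥0∞ := fun y => ENNReal.ofReal (v y ^ (-1 / (t - 1))) with hS
  have hSm : AEMeasurable S m := (hv.pow_const _).ennreal_ofReal
  have heq : ∫⁻ y, ENNReal.ofReal ((u y ^ (-q) * v y) ^ (-1 / q)) ∂m =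
      ∫⁻ y, ((fun y => ENNReal.ofReal (u y)) * fun y => S y ^ ε) y ∂m := by
    refine lintegral_congr_ae ?_
    filter_upwards [hu0, hv0] with y hy hy'
    simp only [Pi.mul_apply, hS]
    rw [ENNReal.ofReal_rpow_of_pos (by positivity), ← ENNReal.ofReal_mul hy.le,
      Real.mul_rpow (by positivity) hy'.le, ← Real.rpow_mul hy.le, ← Real.rpow_mul hy'.le,
      ← hεq]
    congr 2
    · rw [show -q * (-1 / q) = 1 by field_simp, Real.rpow_one]
    · congr 1
      field_simp
  have hH := ENNReal.lintegral_mul_le_Lp_mul_Lq m (Real.HolderConjugate.conjExponent hs)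
    hu.ennreal_ofReal (hSm.pow_const ε)
  rw [heq]
  refine (ENNReal.rpow_le_rpow hH hq0.le).trans_eq ?_
  have hcs : ε * Real.conjExponent s = 1 := by
    rw [hε, Real.conjExponent]; field_simp
  have hcs' : 1 / Real.conjExponent s = ε := by
    rw [hε, Real.conjExponent]; field_simp
  simp only [← ENNReal.rpow_mul, hcs, hcs', ENNReal.rpow_one]
  rw [ENNReal.mul_rpow_of_nonneg _ _ hq0.le, ← ENNReal.rpow_mul, ← ENNReal.rpow_mul, hεq,
    one_div_mul_eq_div]

theorem ReverseHolderA1.memAp {n : ℕ} {u v : (Fin n → ℝ) → ℝ} (hu : IsWeight u) {s t p : ℝ}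
    (hs : 1 < s) (h : ReverseHolderA1 s u) (ht : 1 < t) (hv : MemAp t v)
    (hp : p - 1 = (t - 1) * s / (s - 1)) :
    MemAp p (fun x => u x ^ (1 - p) * v x) := by
  obtain ⟨K, hK, h⟩ := h
  have hs0 : 0 < s := by linarith
  have hs1 : 0 < s - 1 := by linarith
  have ht1 : 0 < t - 1 := by linarith
  set q := p - 1 with hq
  have hq0 : 0 < q := by rw [hp]; positivity
  have hβ : 0 < q / s := by positivity
  rw [show 1 - p = -q by rw [hq]; ring]
  have hfirst : ∀ (c : Fin n → ℝ) (r : ℝ), 0 < r → _ := fun c r hr =>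
    lintegral_rpow_mul_le (v := v) (c := c) (r := r) hu.2 hs0 hq0 hK (by
      filter_upwards [h] with x hx hxc
      rw [lintegral_cond]
      exact hx c r hr hxc)
  refine ⟨⟨fun x => ⟨Metric.closedBall x 1, Metric.closedBall_mem_nhds x one_pos, ?_⟩, ?_⟩, ?_⟩
  · have hpos : ∀ᵐ y, 0 < u y ^ (-q) * v y := by
      filter_upwards [hu.2, hv.1.2] with y hy hy'
      positivity
    refine (lintegral_ofReal_ne_top_iff_integrable
      ((hu.aemeasurable.pow_const _).mul hv.1.aemeasurable).aestronglyMeasurable.restrict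
      (ae_restrict_of_ae (hpos.mono fun y hy => hy.le))).1 ?_
    have hprob := isProbabilityMeasure_cond_closedBall x one_pos
    have h1 := hfirst x 1 one_pos
    set m := ProbabilityTheory.cond (volume : Measure (Fin n → ℝ)) (Metric.closedBall x 1)
      with hm
    have hac : m ≪ volume := ProbabilityTheory.cond_absolutelyContinuous
    have hA : ∫⁻ y, ENNReal.ofReal (u y) ^ s ∂m ≠ 0 := by
      rw [Ne, lintegral_eq_zero_iff' ((hu.aemeasurable.ennreal_ofReal.pow_const s).mono_ac hac)]
      intro h0
      obtain ⟨y, hy, hy'⟩ := (h0.and (hac.ae_le hu.2)).exists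
      simp only [Pi.zero_apply, ENNReal.rpow_eq_zero_iff_of_pos hs0, ENNReal.ofReal_eq_zero] at hy
      linarith
    have hAβ : (∫⁻ y, ENNReal.ofReal (u y) ^ s ∂m) ^ (q / s) ≠ 0 := by
      rwa [Ne, ENNReal.rpow_eq_zero_iff_of_pos hβ]
    have hV : ∫⁻ y, ENNReal.ofReal (v y) ∂m ≠ ⊤ := by
      rw [hm, lintegral_cond]
      exact ENNReal.mul_ne_top (ENNReal.inv_ne_top.2 (volume_closedBall_ne_zero x one_pos))
        (hv.1.lintegral_closedBall_ne_top x 1)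
    have hW : ∫⁻ y, ENNReal.ofReal (u y ^ (-q) * v y) ∂m ≠ ⊤ := by
      intro hW
      rw [hW, ENNReal.mul_top hAβ, top_le_iff] at h1
      exact ENNReal.mul_ne_top (ENNReal.rpow_ne_top_of_nonneg hβ.le hK) hV h1
    intro htop
    change ∫⁻ y in Metric.closedBall x 1, ENNReal.ofReal (u y ^ (-q) * v y) = ⊤ at htop
    rw [hm, lintegral_cond, htop,
      ENNReal.mul_top (ENNReal.inv_ne_zero.2 (volume_closedBall_ne_top x 1))] at hW
    exact hW rfl
  · filter_upwards [hu.2, hv.1.2] with y hy hy'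
    positivity
  · refine lt_of_le_of_lt ?_ (ENNReal.mul_lt_top
      (ENNReal.rpow_lt_top_of_nonneg hβ.le hK) hv.2)
    rw [ApConst_eq]
    refine iSup_le fun c => iSup_le fun r => iSup_le fun hr => ?_
    have h1 := hfirst c r hr
    have hac : ProbabilityTheory.cond (volume : Measure (Fin n → ℝ)) (Metric.closedBall c r) ≪
      volume := ProbabilityTheory.cond_absolutelyContinuous
    have h2 := lintegral_dual_rpow_le (hu.aemeasurable.mono_ac hac)
      (hv.1.aemeasurable.mono_ac hac) (hac.ae_le hu.2) (hac.ae_le hv.1.2) hs ht hp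
    have h3 : (∫⁻ y, ENNReal.ofReal (v y)
          ∂(ProbabilityTheory.cond volume (Metric.closedBall c r))) *
        (∫⁻ y, ENNReal.ofReal (v y ^ (-1 / (t - 1)))
          ∂(ProbabilityTheory.cond volume (Metric.closedBall c r))) ^ (t - 1) ≤ ApConst t v := by
      rw [ApConst_eq]
      exact le_iSup_of_le c (le_iSup_of_le r (le_iSup_of_le hr le_rfl))
    set m := ProbabilityTheory.cond (volume : Measure (Fin n → ℝ)) (Metric.closedBall c r)
    set A := ∫⁻ y, ENNReal.ofReal (u y) ^ s ∂m
    set W := ∫⁻ y, ENNReal.ofReal (u y ^ (-q) * v y) ∂m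
    set B := ∫⁻ y, ENNReal.ofReal (v y ^ (-1 / (t - 1))) ∂m
    calc W * (∫⁻ y, ENNReal.ofReal ((u y ^ (-q) * v y) ^ (-1 / q)) ∂m) ^ q
        ≤ W * (A ^ (q / s) * B ^ (t - 1)) := by gcongr
      _ = A ^ (q / s) * W * B ^ (t - 1) := by ring
      _ ≤ K ^ (q / s) * (∫⁻ y, ENNReal.ofReal (v y) ∂m) * B ^ (t - 1) := by gcongr
      _ = K ^ (q / s) * ((∫⁻ y, ENNReal.ofReal (v y) ∂m) * B ^ (t - 1)) := by ring
      _ ≤ _ := by gcongr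

theorem MemA1.memAp_two {n : ℕ} {v : (Fin n → ℝ) → ℝ} (hv : MemA1 v) : MemAp 2 v := by
  obtain ⟨C, -, hC⟩ := hv.exists_average_le
  refine ⟨hv.1, lt_of_le_of_lt ?_ (ENNReal.ofReal_lt_top (r := C))⟩
  rw [ApConst_eq]
  refine iSup_le fun c => iSup_le fun r => iSup_le fun hr => ?_
  have hprob := isProbabilityMeasure_cond_closedBall c hr
  have hA := ae_cond_closedBall (c := c) (r := r) (hC.mono fun x hx => hx c r hr)
  rw [← lintegral_cond] at hA
  set m := ProbabilityTheory.cond (volume : Measure (Fin n → ℝ)) (Metric.closedBall c r)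
  have hac : m ≪ volume := ProbabilityTheory.cond_absolutelyContinuous
  norm_num
  refine (lintegral_const_mul_le _ _).trans ?_
  calc _ ≤ ∫⁻ _, ENNReal.ofReal C ∂m := by
        refine lintegral_mono_ae ?_
        filter_upwards [hA, hac.ae_le hv.1.2] with y hy hy0
        refine (mul_le_mul' hy le_rfl).trans_eq ?_
        rw [mul_assoc, ← ENNReal.ofReal_mul hy0.le, Real.rpow_neg_one, mul_inv_cancel₀ hy0.ne',
          ENNReal.ofReal_one, mul_one]
    _ = _ := by simp

theorem MemA1.reverseHolder_of_ae_eq {n : ℕ} {u w : (Fin n → ℝ) → ℝ} (hu0 : ∀ᵐ x, 0 < u x)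
    (hw : MemA1 w) {s : ℝ} (hwu : ∀ᵐ x, w x = u x ^ s) : ReverseHolderA1 s u := by
  obtain ⟨C, -, hC⟩ := hw.exists_average_le
  have heq : ∀ᵐ x, ENNReal.ofReal (w x) = ENNReal.ofReal (u x) ^ s := by
    filter_upwards [hu0, hwu] with x hx hx'
    rw [hx', ENNReal.ofReal_rpow_of_pos hx]
  refine ⟨ENNReal.ofReal C, ENNReal.ofReal_ne_top, ?_⟩
  filter_upwards [hC, heq] with x hx hxe c r hr hxc
  rw [← hxe, ← lintegral_congr_ae (ae_restrict_of_ae heq)]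
  exact hx c r hr hxc

/-- Iterating `w ↦ u w^ε` from `w = u` raises `u` to the partial sums of a geometric series. -/
theorem exists_memA1_ae_eq_rpow_geom_sum {n : ℕ} {u : (Fin n → ℝ) → ℝ} (hu : MemA1 u) {ε : ℝ}
    (h : ∀ w : (Fin n → ℝ) → ℝ, MemA1 w → MemA1 (fun x => u x * w x ^ ε)) (k : ℕ) :
    ∃ w, MemA1 w ∧ ∀ᵐ x, w x = u x ^ (∑ i ∈ Finset.range (k + 1), ε ^ i) := by
  induction k with
  | zero => exact ⟨u, hu, by simp⟩
  | succ k ih =>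
    obtain ⟨w, hw, hwu⟩ := ih
    refine ⟨_, h w hw, ?_⟩
    filter_upwards [hu.1.2, hwu] with x hx hx'
    rw [hx', ← Real.rpow_mul hx.le, Finset.sum_range_succ' _ (k + 1), pow_zero,
      add_comm _ (1 : ℝ), Real.rpow_add hx, Real.rpow_one, Finset.sum_mul]
    simp only [pow_succ]

theorem reverseHolder_of_forall_memA1_mul_rpow {n : ℕ} {u : (Fin n → ℝ) → ℝ} (hu : MemA1 u)
    {ε s : ℝ} (hε0 : 0 ≤ ε) (hε1 : ε < 1) (hs0 : 0 < s) (hs : s < (1 - ε)⁻¹)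
    (h : ∀ w : (Fin n → ℝ) → ℝ, MemA1 w → MemA1 (fun x => u x * w x ^ ε)) :
    ReverseHolderA1 s u := by
  have hlim := (hasSum_geometric_of_lt_one hε0 hε1).tendsto_sum_nat
  obtain ⟨k, hk⟩ := (((Filter.tendsto_add_atTop_iff_nat 1).2 hlim).eventually
    (lt_mem_nhds hs)).exists
  obtain ⟨w, hw, hwu⟩ := exists_memA1_ae_eq_rpow_geom_sum hu h k
  exact (hw.reverseHolder_of_ae_eq hu.1.2 hwu).mono hu.1.aemeasurable hs0 hk.le

/-- If `u ∈ A₁` and `v ∈ A_∞`, then there exists `1 < p₀ < ∞` with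
`u^{1-p₀} v ∈ A_{p₀}`. Moreover, if `v ∈ A_t` with `t > 1` and `ε₀ ∈ (0,1)` is such that
`u·w^ε ∈ A₁` for every `w ∈ A₁` and every `0 < ε < ε₀`, then one may take
`p₀ = 2(t-1)/ε₀ + 1`. -/
theorem exists_p0_uPow_mul_v_mem_Ap
    (n : ℕ) (u v : (Fin n → ℝ) → ℝ) (hu : MemA1 u) (hv : MemAinfty v) :
    (∃ p₀ : ℝ, 1 < p₀ ∧ MemAp p₀ (fun x => u x ^ (1 - p₀) * v x)) ∧
      (∀ t : ℝ, 1 < t → MemAp t v →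
        ∀ ε₀ : ℝ, 0 < ε₀ → ε₀ < 1 →
          (∀ w : (Fin n → ℝ) → ℝ, MemA1 w →
            ∀ ε : ℝ, 0 < ε → ε < ε₀ → MemA1 (fun x => u x * w x ^ ε)) →
          MemAp (2 * (t - 1) / ε₀ + 1)
            (fun x => u x ^ (1 - (2 * (t - 1) / ε₀ + 1)) * v x)) := by
  refine ⟨?_, fun t ht hvt ε₀ hε₀ hε₁ h => ?_⟩
  · obtain ⟨s, hs, hsu⟩ := hu.exists_reverseHolder
    obtain ⟨t, ht, hvt⟩ : ∃ t : ℝ, 1 < t ∧ MemAp t v :=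
      hv.elim (fun h => ⟨2, one_lt_two, h.memAp_two⟩) id
    have hs1 : 0 < s - 1 := by linarith
    have ht1 : 0 < t - 1 := by linarith
    have hp : 0 < (t - 1) * s / (s - 1) := by positivity
    exact ⟨(t - 1) * s / (s - 1) + 1, by linarith, hsu.memAp hu.1 hs ht hvt (by ring)⟩
  · have hpos : 0 < 1 - ε₀ / 2 := by linarith
    have hs : 1 < (1 - ε₀ / 2)⁻¹ := (one_lt_inv₀ hpos).2 (by linarith)
    have hsu : ReverseHolderA1 (1 - ε₀ / 2)⁻¹ u :=
      reverseHolder_of_forall_memA1_mul_rpow hu (ε := 3 * ε₀ / 4) (by positivity) (by linarith)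
        (by positivity) (inv_strictAnti₀ (by linarith) (by linarith))
        fun w hw => h w hw _ (by positivity) (by linarith)
    refine hsu.memAp hu.1 hs ht hvt ?_
    have h2 : (1 - ε₀ / 2)⁻¹ - 1 = (1 - ε₀ / 2)⁻¹ * (ε₀ / 2) := by
      linarith [mul_inv_cancel₀ hpos.ne']
    have hinv : (1 - ε₀ / 2)⁻¹ ≠ 0 := inv_ne_zero hpos.ne'
    rw [h2, add_sub_cancel_right]
    generalize (1 - ε₀ / 2)⁻¹ = a at hinv
    field_simp

end
end

section
/- Fix ρ>0 and let Φ_ρ(t) := t·log(e+t)^ρ. There exist constants c_1, c_2 > 0 depending only on ρ such that c_1 · s/log(e+s)^ρ ≤ Φ_ρ^{-1}(s) ≤ c_2 · s/log(e+s)^ρ for all s>0. Consequently, if B(t) := 1/Φ_ρ(1/t) and B_r(t) := B(t^r) for r ≥ 1, then c_1' · t^{1/r} log(e+1/t)^{ρ/r} ≤ B_r^{-1}(t) ≤ c_2' · t^{1/r} log(e+1/t)^{ρ/r} for all t>0, with constants c_1', c_2' depending only on ρ and independent of r. -/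
open MeasureTheory Set
open scoped ENNReal

noncomputable section

/-- `Φ_ρ(t) = t log(e+t)^ρ`. -/
def PhiRho (ρ : ℝ) (t : ℝ) : ℝ := t * Real.log (Real.exp 1 + t) ^ ρ

/-- `B(t) = 1/Φ_ρ(1/t)`. -/
def Brho (ρ : ℝ) (t : ℝ) : ℝ := 1 / PhiRho ρ (1 / t)

/-- `B_r(t) = B(t^r)`. -/
def BrhoR (ρ r : ℝ) (t : ℝ) : ℝ := Brho ρ (t ^ r)

lemma one_le_log_exp_one_add {t : ℝ} (ht : 0 ≤ t) : 1 ≤ Real.log (Real.exp 1 + t) := by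
  rw [Real.le_log_iff_exp_le (by positivity)]
  linarith

lemma le_PhiRho {ρ t : ℝ} (hρ : 0 ≤ ρ) (ht : 0 ≤ t) : t ≤ PhiRho ρ t :=
  le_mul_of_one_le_right ht (Real.one_le_rpow (one_le_log_exp_one_add ht) hρ)

lemma PhiRho_zero (ρ : ℝ) : PhiRho ρ 0 = 0 := zero_mul _

lemma continuousOn_PhiRho (ρ : ℝ) : ContinuousOn (PhiRho ρ) (Ici 0) := by
  refine continuousOn_id.mul (ContinuousOn.rpow_const (ContinuousOn.log (by fun_prop) ?_) ?_)
  · intro x (hx : 0 ≤ x)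
    positivity
  · intro x hx
    exact Or.inl (zero_lt_one.trans_le (one_le_log_exp_one_add hx)).ne'

lemma exists_PhiRho_eq {ρ s : ℝ} (hρ : 0 ≤ ρ) (hs : 0 ≤ s) : ∃ t ∈ Ici (0 : ℝ), PhiRho ρ t = s := by
  have h := intermediate_value_Icc hs ((continuousOn_PhiRho ρ).mono Icc_subset_Ici_self)
  obtain ⟨t, ht, hts⟩ := h ⟨(PhiRho_zero ρ).trans_le hs, le_PhiRho hρ hs⟩
  exact ⟨t, ht.1, hts⟩

lemma log_exp_one_add_PhiRho_le {ρ t : ℝ} (hρ : 0 ≤ ρ) (ht : 0 ≤ t) :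
    Real.log (Real.exp 1 + PhiRho ρ t) ≤ (1 + ρ) * Real.log (Real.exp 1 + t) := by
  have hL := one_le_log_exp_one_add ht
  have hL0 : 0 < Real.log (Real.exp 1 + t) := by linarith
  have hP := Real.one_le_rpow hL hρ
  have hE := Real.exp_pos 1
  calc Real.log (Real.exp 1 + PhiRho ρ t)
      ≤ Real.log ((Real.exp 1 + t) * Real.log (Real.exp 1 + t) ^ ρ) := by
        have h0 : 0 ≤ PhiRho ρ t := ht.trans (le_PhiRho hρ ht)
        refine Real.log_le_log (by positivity) ?_
        rw [add_mul]
        exact add_le_add_left (le_mul_of_one_le_right hE.le hP) _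
    _ = Real.log (Real.exp 1 + t) + ρ * Real.log (Real.log (Real.exp 1 + t)) := by
        rw [Real.log_mul (by positivity) (by positivity), Real.log_rpow hL0]
    _ ≤ (1 + ρ) * Real.log (Real.exp 1 + t) := by
        have h := mul_le_mul_of_nonneg_left (Real.log_le_self hL0.le) hρ
        linarith

lemma PhiRho_div_log_le {ρ t : ℝ} (hρ : 0 ≤ ρ) (ht : 0 ≤ t) :
    PhiRho ρ t / Real.log (Real.exp 1 + PhiRho ρ t) ^ ρ ≤ t := by
  have hts := le_PhiRho hρ ht
  have hLs := one_le_log_exp_one_add (ht.trans hts)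
  have hL := one_le_log_exp_one_add ht
  rw [div_le_iff₀ (by positivity)]
  exact mul_le_mul_of_nonneg_left (Real.rpow_le_rpow (by linarith)
    (Real.log_le_log (by positivity) (by linarith)) hρ) ht

lemma le_PhiRho_div_log {ρ t : ℝ} (hρ : 0 ≤ ρ) (ht : 0 ≤ t) :
    t ≤ (1 + ρ) ^ ρ * PhiRho ρ t / Real.log (Real.exp 1 + PhiRho ρ t) ^ ρ := by
  have hLs := one_le_log_exp_one_add (ht.trans (le_PhiRho hρ ht))
  have hL := one_le_log_exp_one_add ht
  rw [le_div_iff₀ (by positivity)]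
  calc t * Real.log (Real.exp 1 + PhiRho ρ t) ^ ρ
      ≤ t * ((1 + ρ) * Real.log (Real.exp 1 + t)) ^ ρ :=
        mul_le_mul_of_nonneg_left (Real.rpow_le_rpow (by linarith)
          (log_exp_one_add_PhiRho_le hρ ht) hρ) ht
    _ = (1 + ρ) ^ ρ * PhiRho ρ t := by
        rw [Real.mul_rpow (by linarith) (by linarith), PhiRho]
        ring

lemma PhiRho_eq_inv_of_Brho_eq {ρ y t : ℝ} (h : Brho ρ y = t) : PhiRho ρ y⁻¹ = t⁻¹ := by
  simp [← h, Brho]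

lemma exists_BrhoR_eq {ρ r t : ℝ} (hρ : 0 ≤ ρ) (hr : r ≠ 0) (ht : 0 ≤ t) :
    ∃ x ∈ Ici (0 : ℝ), BrhoR ρ r x = t := by
  obtain ⟨u, hu, hut⟩ := exists_PhiRho_eq hρ (inv_nonneg.2 ht)
  have hu' : 0 ≤ u⁻¹ := inv_nonneg.2 hu
  refine ⟨u⁻¹ ^ r⁻¹, Real.rpow_nonneg hu' _, ?_⟩
  simp [BrhoR, Brho, Real.rpow_inv_rpow hu' hr, hut]

lemma Brho_bounds {ρ y t : ℝ} (hρ : 0 ≤ ρ) (hy : 0 ≤ y) (ht : 0 < t) (h : Brho ρ y = t) :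
    ((1 + ρ) ^ ρ)⁻¹ * (t * Real.log (Real.exp 1 + 1 / t) ^ ρ) ≤ y ∧
      y ≤ t * Real.log (Real.exp 1 + 1 / t) ^ ρ := by
  have hP := PhiRho_eq_inv_of_Brho_eq h
  have hy0 : 0 < y := by
    refine hy.lt_of_ne' fun hy0 => (inv_pos.2 ht).ne' ?_
    rw [← hP, hy0, inv_zero, PhiRho_zero]
  have hlow := PhiRho_div_log_le hρ (inv_nonneg.2 hy)
  have hup := le_PhiRho_div_log hρ (inv_nonneg.2 hy)
  have hL := one_le_log_exp_one_add (inv_nonneg.2 ht.le)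
  rw [hP] at hlow hup
  rw [one_div]
  have hQ : 0 < Real.log (Real.exp 1 + t⁻¹) ^ ρ := by positivity
  have hC : 0 < (1 + ρ) ^ ρ := by positivity
  constructor
  · rw [← inv_le_inv₀ hy0 (by positivity)]
    refine hup.trans_eq ?_
    field_simp
  · rw [← inv_le_inv₀ (by positivity) hy0]
    refine Eq.trans_le ?_ hlow
    field_simp

lemma BrhoR_bounds {ρ r x t : ℝ} (hρ : 0 ≤ ρ) (hr : 1 ≤ r) (hx : 0 ≤ x) (ht : 0 < t)
    (h : BrhoR ρ r x = t) :
    ((1 + ρ) ^ ρ)⁻¹ * t ^ (1 / r) * Real.log (Real.exp 1 + 1 / t) ^ (ρ / r) ≤ x ∧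
      x ≤ t ^ (1 / r) * Real.log (Real.exp 1 + 1 / t) ^ (ρ / r) := by
  have hr0 : 0 < r := by linarith
  obtain ⟨hlow, hup⟩ := Brho_bounds hρ (Real.rpow_nonneg hx r) ht h
  have hL := one_le_log_exp_one_add (one_div_nonneg.2 ht.le)
  have hL0 : 0 ≤ Real.log (Real.exp 1 + 1 / t) := by linarith
  have hroot : (t * Real.log (Real.exp 1 + 1 / t) ^ ρ) ^ (1 / r) =
      t ^ (1 / r) * Real.log (Real.exp 1 + 1 / t) ^ (ρ / r) := by
    rw [Real.mul_rpow ht.le (by positivity), ← Real.rpow_mul hL0, mul_one_div]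
  have hxr : (x ^ r) ^ (1 / r) = x := by
    rw [one_div, Real.rpow_rpow_inv hx hr0.ne']
  have hC : 0 < ((1 + ρ) ^ ρ)⁻¹ := by positivity
  have hC1 : ((1 + ρ) ^ ρ)⁻¹ ≤ 1 := inv_le_one_of_one_le₀ (Real.one_le_rpow (by linarith) hρ)
  have hCr : ((1 + ρ) ^ ρ)⁻¹ ≤ ((1 + ρ) ^ ρ)⁻¹ ^ (1 / r) :=
    Real.self_le_rpow_of_le_one hC.le hC1 ((div_le_one hr0).2 hr)
  constructor
  · rw [mul_assoc, ← hroot]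
    calc ((1 + ρ) ^ ρ)⁻¹ * (t * Real.log (Real.exp 1 + 1 / t) ^ ρ) ^ (1 / r)
        ≤ ((1 + ρ) ^ ρ)⁻¹ ^ (1 / r) * (t * Real.log (Real.exp 1 + 1 / t) ^ ρ) ^ (1 / r) :=
          mul_le_mul_of_nonneg_right hCr (by positivity)
      _ = (((1 + ρ) ^ ρ)⁻¹ * (t * Real.log (Real.exp 1 + 1 / t) ^ ρ)) ^ (1 / r) :=
          (Real.mul_rpow hC.le (by positivity)).symm
      _ ≤ (x ^ r) ^ (1 / r) := Real.rpow_le_rpow (by positivity) hlow (by positivity)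
      _ = x := hxr
  · rw [← hroot]
    exact hxr.symm.trans_le (Real.rpow_le_rpow (by positivity) hup (by positivity))

/-- Fix `ρ > 0`. Then `Φ_ρ⁻¹(s) ≃ s / log(e+s)^ρ` with constants depending only on `ρ`;
consequently, for `B(t) = 1/Φ_ρ(1/t)` and `B_r(t) = B(t^r)`, `r ≥ 1`, one has
`B_r⁻¹(t) ≃ t^{1/r} log(e + 1/t)^{ρ/r}` with constants depending only on `ρ` and
independent of `r`. -/
theorem PhiRho_inv_equiv (ρ : ℝ) (hρ : 0 < ρ) :
    (∃ c₁ c₂ : ℝ, 0 < c₁ ∧ 0 < c₂ ∧ ∀ s : ℝ, 0 < s →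
        c₁ * s / Real.log (Real.exp 1 + s) ^ ρ ≤
            Function.invFunOn (PhiRho ρ) (Set.Ici 0) s ∧
          Function.invFunOn (PhiRho ρ) (Set.Ici 0) s ≤
            c₂ * s / Real.log (Real.exp 1 + s) ^ ρ) ∧
      (∃ c₁' c₂' : ℝ, 0 < c₁' ∧ 0 < c₂' ∧ ∀ r : ℝ, 1 ≤ r → ∀ t : ℝ, 0 < t →
        c₁' * t ^ (1 / r) * Real.log (Real.exp 1 + 1 / t) ^ (ρ / r) ≤
            Function.invFunOn (BrhoR ρ r) (Set.Ici 0) t ∧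
          Function.invFunOn (BrhoR ρ r) (Set.Ici 0) t ≤
            c₂' * t ^ (1 / r) * Real.log (Real.exp 1 + 1 / t) ^ (ρ / r)) := by
  refine ⟨⟨1, (1 + ρ) ^ ρ, one_pos, by positivity, fun s hs => ?_⟩,
    ⟨((1 + ρ) ^ ρ)⁻¹, 1, by positivity, one_pos, fun r hr t ht => ?_⟩⟩
  · have hex := exists_PhiRho_eq hρ.le hs.le
    have heq := Function.invFunOn_eq hex
    have hmem : 0 ≤ Function.invFunOn (PhiRho ρ) (Ici 0) s := Function.invFunOn_mem hex
    have hlow := PhiRho_div_log_le hρ.le hmem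
    have hup := le_PhiRho_div_log hρ.le hmem
    rw [heq] at hlow hup
    exact ⟨by rwa [one_mul], hup⟩
  · have hex := exists_BrhoR_eq hρ.le (zero_lt_one.trans_le hr).ne' ht.le
    rw [one_mul]
    exact BrhoR_bounds hρ.le hr (Function.invFunOn_mem hex) ht (Function.invFunOn_eq hex)

end
end
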